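/- Let O = O(ñ, M) ⊂ M_n(D_p) be a tiled order in standard form. The following are equivalent: (1) ρ(O^•) < ∞; (2) m_ij + m_ji = 1 for all i ≠ j; (3) O is hereditary. Moreover, if these fail, then there exists a set of atoms {α_k, α'_k : k ∈ ℤ_{≥1}} of O^• satisfying α_k α'_k = α_1^k (α'_1)^k for all k; in particular ρ_k(O^•) = ∞ for all k ≥ 2, and for all k ∈ ℤ_{≥1} one has 2·ℤ_{≥1} ⊆ U_{2k}(O^•) and 1 + 2·ℤ_{≥1} ⊆ U_{2k+1}(O^•). -/

import Mathlib

open scoped ENNReal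

namespace Paper

section Factorization

variable {M : Type*}

/-- `a` is an atom (irreducible element) of the monoid `M`. -/
def IsAtomM [Monoid M] (a : M) : Prop :=
  ¬ IsUnit a ∧ ∀ b c : M, a = b * c → IsUnit b ∨ IsUnit c

/-- `a` has a factorization of length `k`: it is a unit times a product of `k` atoms. -/
def HasLen [Monoid M] (a : M) (k : ℕ) : Prop :=
  ∃ (ε : M) (u : Fin k → M), IsUnit ε ∧ (∀ i, IsAtomM (u i)) ∧
    a = ε * (List.ofFn u).prod

/-- The set of lengths `L(a)` of `a`. -/
def LenSet [Monoid M] (a : M) : Set ℕ := {k | HasLen a k}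

/-- A monoid is atomic if every element admits a factorization into atoms. -/
def Atomic (M : Type*) [Monoid M] : Prop := ∀ a : M, ∃ k : ℕ, HasLen a k

/-- `sup L(a)`, valued in `ℝ≥0∞`. -/
noncomputable def supLen [Monoid M] (a : M) : ℝ≥0∞ :=
  ⨆ k ∈ LenSet a, (k : ℝ≥0∞)

/-- `min L(a)`. -/
noncomputable def minLen [Monoid M] (a : M) : ℕ := sInf (LenSet a)

open Classical in
/-- The elasticity `ρ(a) = sup L(a) / min L(a)` of an element (`1` for units). -/
noncomputable def elastOf [Monoid M] (a : M) : ℝ≥0∞ :=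
  if IsUnit a then 1 else supLen a / (minLen a : ℝ≥0∞)

/-- The elasticity `ρ(M) = sup {ρ(a) | a ∈ M}` of a monoid. -/
noncomputable def elasticity (M : Type*) [Monoid M] : ℝ≥0∞ :=
  ⨆ a : M, elastOf a

/-- The refined elasticity `ρ_k(M) = sup {sup L(a) | min L(a) ≤ k}`. -/
noncomputable def refinedElasticity (M : Type*) [Monoid M] (k : ℕ) : ℝ≥0∞ :=
  ⨆ a : M, ⨆ (_ : minLen a ≤ k), supLen a

/-- The union `U_k(M)` of sets of lengths containing `k`. -/
def lengthUnion (M : Type*) [Monoid M] (k : ℕ) : Set ℕ :=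
  {m | ∃ a : M, k ∈ LenSet a ∧ m ∈ LenSet a}

/-- Transfer homomorphism between monoids. -/
def IsTransferHom {M N : Type*} [Monoid M] [Monoid N] (φ : M →* N) : Prop :=
  (∀ a : M, IsUnit (φ a) ↔ IsUnit a) ∧
  (∀ d : N, ∃ (u v : Nˣ) (a : M), d = ↑u * φ a * ↑v) ∧
  (∀ (a : M) (b₁ b₂ : N), φ a = b₁ * b₂ →
    ∃ (a₁ a₂ : M) (ε : Nˣ), a = a₁ * a₂ ∧ φ a₁ = b₁ * ↑ε ∧ φ a₂ = ↑ε⁻¹ * b₂)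

/-- The restricted product `∏'_{i ∈ I} T_i` of a family of monoids: all but finitely
many components are units. -/
def restrictedProd {I : Type*} (T : I → Type*) [∀ i, Monoid (T i)] :
    Submonoid (∀ i, T i) where
  carrier := {α | {i | ¬ IsUnit (α i)}.Finite}
  one_mem' := by
    have : {i | ¬ IsUnit ((1 : ∀ i, T i) i)} = ∅ := by
      ext i; simp
    simp only [Set.mem_setOf_eq, this]
    exact Set.finite_empty
  mul_mem' := by
    intro a b ha hb
    refine Set.Finite.subset (Set.Finite.union ha hb) ?_
    intro i hi
    by_contra h
    simp only [Set.mem_union, Set.mem_setOf_eq, not_or] at h  -- h : IsUnit (a i) ∧ IsUnit (b i)? no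
    exact hi (IsUnit.mul (not_not.mp h.1) (not_not.mp h.2))

/-- A zero-sumfree sequence over a commutative monoid (written multiplicatively):
no nonempty subsequence has product `1`. -/
def ZeroSumfree {G : Type*} [CommMonoid G] (s : Multiset G) : Prop :=
  ∀ t : Multiset G, t ≤ s → t ≠ 0 → t.prod ≠ 1

/-- The Davenport constant: `1 +` the maximal length of a zero-sumfree sequence. -/
noncomputable def davenport (G : Type*) [CommMonoid G] : ℕ :=
  1 + sSup {n : ℕ | ∃ s : Multiset G, ZeroSumfree s ∧ Multiset.card s = n}

/-- The `T`-block monoid `B_T(G, ι)` over `G` induced by `ι : T → G`: pairs `(S, α)`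
of a sequence `S ∈ F(G)` and `α ∈ T` with `σ(S)·ι(α) = 1`. -/
def blockMonoid {G T : Type*} [CommMonoid G] [Monoid T] (ι : T →* G) :
    Submonoid (Multiplicative (Multiset G) × T) where
  carrier := {x | (Multiplicative.toAdd x.1).prod * ι x.2 = 1}
  one_mem' := by simp
  mul_mem' := by
    intro a b ha hb
    simp only [Set.mem_setOf_eq, Prod.fst_mul, Prod.snd_mul, toAdd_mul, Multiset.prod_add,
      map_mul] at *
    rw [mul_mul_mul_comm, ha, hb, one_mul]

/-- Every right ideal is projective. -/
def IsHereditaryRing (R : Type*) [Ring R] : Prop :=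
  ∀ I : Submodule Rᵐᵒᵖ R, Module.Projective Rᵐᵒᵖ I

end Factorization

end Paper

namespace Paper

/-- The data of a central division algebra `D` over a non-archimedean local field `K_p`
(a completion of a number field at a finite place), together with its (normalized discrete)
valuations `v` on `K_p` and `w = v ∘ nrd` on `D`, a uniformizer `π` of `R_p`, a generator
`ϖ` of the maximal ideal of the unique maximal order `Δ_p = {x | w x ≥ 0}`, and the
reduced norms of the matrix algebras `M_ι(D)`, characterized via the reduced
characteristic polynomial. -/
structure LocalCSA where
  /-- the local field `K_p` -/
  Kp : Type
  [fieldKp : Field Kp]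
  /-- the normalized discrete valuation on `K_p` -/
  v : Kp → ℤ
  v_mul : ∀ x y : Kp, x ≠ 0 → y ≠ 0 → v (x * y) = v x + v y
  v_add : ∀ x y : Kp, x ≠ 0 → y ≠ 0 → x + y ≠ 0 → min (v x) (v y) ≤ v (x + y)
  v_neg : ∀ x : Kp, v (-x) = v x
  /-- a uniformizer of the valuation ring `R_p` -/
  piK : Kp
  piK_ne : piK ≠ 0
  v_piK : v piK = 1
  /-- `K_p` is complete with respect to `v` -/
  complete : ∀ f : ℕ → Kp,
    (∀ N : ℤ, ∃ M : ℕ, ∀ m n : ℕ, M ≤ m → M ≤ n → f m - f n = 0 ∨ N ≤ v (f m - f n)) →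
    ∃ L : Kp, ∀ N : ℤ, ∃ M : ℕ, ∀ m : ℕ, M ≤ m → f m - L = 0 ∨ N ≤ v (f m - L)
  /-- the central division algebra `D_p` -/
  D : Type
  [divD : DivisionRing D]
  [algD : Algebra Kp D]
  [fdD : FiniteDimensional Kp D]
  centralD : Subalgebra.center Kp D = ⊥
  /-- the degree `d` of `D_p`, so `dim_{K_p} D_p = d²` -/
  d : ℕ
  degD : Module.finrank Kp D = d * d
  /-- the valuation `w = v ∘ nrd` on `D_p` -/
  w : D → ℤ
  w_mul : ∀ x y : D, x ≠ 0 → y ≠ 0 → w (x * y) = w x + w y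
  w_add : ∀ x y : D, x ≠ 0 → y ≠ 0 → x + y ≠ 0 → min (w x) (w y) ≤ w (x + y)
  w_neg : ∀ x : D, w (-x) = w x
  w_algebraMap : ∀ x : Kp, x ≠ 0 → w (algebraMap Kp D x) = d * v x
  w_surj : ∀ k : ℤ, ∃ x : D, x ≠ 0 ∧ w x = k
  /-- a generator `ϖ` of the maximal ideal `𝔓` of `Δ_p` -/
  ϖ : D
  ϖ_ne : ϖ ≠ 0
  w_ϖ : w ϖ = 1
  /-- the reduced norm of the central simple algebra `M_ι(D_p)` over `K_p` -/
  nrd : ∀ {ι : Type} [Fintype ι] [DecidableEq ι], Matrix ι ι D → Kp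
  nrd_mul : ∀ {ι : Type} [Fintype ι] [DecidableEq ι] (B C : Matrix ι ι D),
    nrd (B * C) = nrd B * nrd C
  nrd_one : ∀ {ι : Type} [Fintype ι] [DecidableEq ι], nrd (1 : Matrix ι ι D) = 1
  nrd_charpoly : ∀ {ι : Type} [Fintype ι] [DecidableEq ι] (B : Matrix ι ι D),
    ∃ f : Polynomial Kp, f.Monic ∧ f.natDegree = Fintype.card ι * d ∧
      f ^ (Fintype.card ι * d) = LinearMap.charpoly (LinearMap.mulLeft Kp B) ∧
      nrd B = (-1) ^ (Fintype.card ι * d) * f.coeff 0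
  /-- cancellative = nonzero reduced norm = invertible over `M_ι(D_p)` -/
  nrd_unit : ∀ {ι : Type} [Fintype ι] [DecidableEq ι] (B : Matrix ι ι D),
    nrd B ≠ 0 ↔ IsUnit B
  /-- the reduced norm of a matrix with integral entries is integral -/
  nrd_int : ∀ {ι : Type} [Fintype ι] [DecidableEq ι] (B : Matrix ι ι D),
    (∀ i j, B i j = 0 ∨ 0 ≤ w (B i j)) → nrd B = 0 ∨ 0 ≤ v (nrd B)

attribute [instance] LocalCSA.fieldKp LocalCSA.divD LocalCSA.algD LocalCSA.fdD

namespace LocalCSA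

variable (L : LocalCSA)

lemma w_one : L.w 1 = 0 := by
  have h := L.w_mul 1 1 one_ne_zero one_ne_zero
  rw [one_mul] at h
  omega

/-- The unique maximal order `Δ_p = {x ∈ D_p | w(x) ≥ 0}`. -/
def Delta : Set L.D := {x | x = 0 ∨ 0 ≤ L.w x}

/-- The fractional-power `𝔓^m = {x ∈ D_p | w(x) ≥ m}` of the maximal ideal of `Δ_p`. -/
def Ppow (m : ℤ) : Set L.D := {x | x = 0 ∨ m ≤ L.w x}

lemma Ppow_zero_mem (m : ℤ) : (0 : L.D) ∈ L.Ppow m := Or.inl rfl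

lemma Ppow_add_mem {m : ℤ} {x y : L.D} (hx : x ∈ L.Ppow m) (hy : y ∈ L.Ppow m) :
    x + y ∈ L.Ppow m := by
  by_cases hx0 : x = 0
  · subst hx0; simpa using hy
  by_cases hy0 : y = 0
  · subst hy0; simpa using hx
  by_cases hxy : x + y = 0
  · exact Or.inl hxy
  have hwx : m ≤ L.w x := hx.resolve_left hx0
  have hwy : m ≤ L.w y := hy.resolve_left hy0
  exact Or.inr (le_trans (le_min hwx hwy) (L.w_add x y hx0 hy0 hxy))

lemma Ppow_mul_mem {s t : ℤ} {x y : L.D} (hx : x ∈ L.Ppow s) (hy : y ∈ L.Ppow t) :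
    x * y ∈ L.Ppow (s + t) := by
  by_cases hx0 : x = 0
  · exact Or.inl (by simp [hx0])
  by_cases hy0 : y = 0
  · exact Or.inl (by simp [hy0])
  have hwx : s ≤ L.w x := hx.resolve_left hx0
  have hwy : t ≤ L.w y := hy.resolve_left hy0
  exact Or.inr (by rw [L.w_mul x y hx0 hy0]; omega)

lemma Ppow_neg_mem {m : ℤ} {x : L.D} (hx : x ∈ L.Ppow m) : -x ∈ L.Ppow m := by
  rcases hx with rfl | hx
  · exact Or.inl (by simp)
  · exact Or.inr (by rw [L.w_neg]; exact hx)

lemma Ppow_mono {s t : ℤ} (h : s ≤ t) : L.Ppow t ⊆ L.Ppow s := by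
  intro x hx
  rcases hx with rfl | hx
  · exact Or.inl rfl
  · exact Or.inr (le_trans h hx)

lemma Ppow_one_mem {m : ℤ} (h : m ≤ 0) : (1 : L.D) ∈ L.Ppow m := by
  exact Or.inr (by rw [L.w_one]; exact h)

end LocalCSA

end Paper

namespace Paper

namespace LocalCSA

variable (L : LocalCSA)

/-- The exponent matrix conditions for a tiled order in standard form. -/
def IsStdForm {r : ℕ} (m : Fin r → Fin r → ℤ) : Prop :=
  (∀ i, m i i = 0) ∧ (∀ i j k, m i k ≤ m i j + m j k) ∧ (∀ i j, i ≠ j → 0 < m i j + m j i)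

/-- The block index set of the partition `ñ = (n_1, …, n_r)` of `n`: an index in block
`i` is a pair `⟨i, x⟩` with `x ∈ Fin (n_i)`. -/
abbrev BlockIdx {r : ℕ} (nv : Fin r → ℕ) : Type := (i : Fin r) × Fin (nv i)

/-- The underlying set of the order `O(ñ, M) = ⊕_{i,j} M_{n_i × n_j}(𝔓^{m_{ij}})`,
for matrices indexed by an index set `ι` with block-assignment `β : ι → Fin r`. -/
def stdSet {r : ℕ} (m : Fin r → Fin r → ℤ) {ι : Type} (β : ι → Fin r) :
    Set (Matrix ι ι L.D) :=
  {B | ∀ a b : ι, B a b ∈ L.Ppow (m (β a) (β b))}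

/-- The order `O(ñ, M)` as a subring of the matrix algebra. -/
def stdOrder {r : ℕ} (m : Fin r → Fin r → ℤ) {ι : Type} [Fintype ι] [DecidableEq ι]
    (β : ι → Fin r) (h0 : ∀ i, m i i = 0) (htri : ∀ i j k, m i k ≤ m i j + m j k) :
    Subring (Matrix ι ι L.D) where
  carrier := L.stdSet m β
  zero_mem' := fun a b => by simpa using L.Ppow_zero_mem _
  one_mem' := by
    intro a b
    by_cases h : a = b
    · subst h
      simpa [Matrix.one_apply_eq] using L.Ppow_one_mem (le_of_eq (h0 (β a)))
    · simpa [Matrix.one_apply_ne h] using L.Ppow_zero_mem _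
  add_mem' := by
    intro B C hB hC a b
    simpa [Matrix.add_apply] using L.Ppow_add_mem (hB a b) (hC a b)
  neg_mem' := by
    intro B hB a b
    simpa [Matrix.neg_apply] using L.Ppow_neg_mem (hB a b)
  mul_mem' := by
    intro B C hB hC a b
    rw [Matrix.mul_apply]
    refine Finset.sum_induction _ (· ∈ L.Ppow (m (β a) (β b)))
      (fun x y hx hy => L.Ppow_add_mem hx hy) (L.Ppow_zero_mem _) ?_
    intro c _
    exact L.Ppow_mono (htri (β a) (β c) (β b)) (L.Ppow_mul_mem (hB a c) (hC c b))

/-- The monoid `O^•` of cancellative elements (nonzero reduced norm) of a subring `O`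
of a matrix algebra over `D_p`. -/
def matDot {ι : Type} [Fintype ι] [DecidableEq ι] (O : Subring (Matrix ι ι L.D)) :
    Submonoid (Matrix ι ι L.D) where
  carrier := {B | B ∈ O ∧ L.nrd B ≠ 0}
  one_mem' := ⟨Subring.one_mem O, by rw [L.nrd_one]; exact one_ne_zero⟩
  mul_mem' := by
    intro B C hB hC
    exact ⟨Subring.mul_mem O hB.1 hC.1, by rw [L.nrd_mul]; exact mul_ne_zero hB.2 hC.2⟩

/-- `O` is an `R_p`-order in the algebra `B`: it contains the image of the valuation
ring `R_p = {x | v(x) ≥ 0}`, is finitely generated as an `R_p`-module, and spans `B`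
over `K_p`. -/
def IsOrderIn {Kp : Type} [Field Kp] (v : Kp → ℤ) {B : Type} [Ring B] (ψ : Kp →+* B)
    (O : Subring B) : Prop :=
  (∀ x : Kp, (x = 0 ∨ 0 ≤ v x) → ψ x ∈ O) ∧
  (∃ s : Finset B, ↑s ⊆ (O : Set B) ∧ ∀ b ∈ O, ∃ c : B → Kp,
      (∀ y : B, c y = 0 ∨ 0 ≤ v (c y)) ∧ b = ∑ y ∈ s, ψ (c y) * y) ∧
  (∀ b : B, ∃ x : Kp, x ≠ 0 ∧ ψ x * b ∈ O)

/-- A local order `O ⊆ M_n(D_p)` is tiled if it contains a conjugate of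
`Diag(Δ_p, …, Δ_p)`. -/
def IsTiledOrder {n : ℕ} (O : Subring (Matrix (Fin n) (Fin n) L.D)) : Prop :=
  IsOrderIn L.v (algebraMap L.Kp (Matrix (Fin n) (Fin n) L.D)) O ∧
  ∃ u : (Matrix (Fin n) (Fin n) L.D)ˣ,
    ∀ B : Matrix (Fin n) (Fin n) L.D,
      (∀ i j, (i = j → B i j ∈ L.Delta) ∧ (i ≠ j → B i j = 0)) →
      u.val * B * (u⁻¹).val ∈ O

end LocalCSA

end Paper

namespace Paper

namespace LocalCSA

section Basics

variable (L : LocalCSA)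

lemma Psum_mem {κ : Type*} {e : ℤ} (s : Finset κ) (f : κ → L.D)
    (h : ∀ c ∈ s, f c ∈ L.Ppow e) : ∑ c ∈ s, f c ∈ L.Ppow e :=
  Finset.sum_induction f (· ∈ L.Ppow e) (fun _ _ hx hy => L.Ppow_add_mem hx hy)
    (L.Ppow_zero_mem _) h

lemma Pmul_le {s t e : ℤ} {x y : L.D} (hx : x ∈ L.Ppow s) (hy : y ∈ L.Ppow t) (h : e ≤ s + t) :
    x * y ∈ L.Ppow e := L.Ppow_mono h (L.Ppow_mul_mem hx hy)

lemma Psub_mem {e : ℤ} {x y : L.D} (hx : x ∈ L.Ppow e) (hy : y ∈ L.Ppow e) :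
    x - y ∈ L.Ppow e := by
  rw [sub_eq_add_neg]
  exact L.Ppow_add_mem hx (L.Ppow_neg_mem hy)

lemma w_inv {x : L.D} (hx : x ≠ 0) : L.w x⁻¹ = - L.w x := by
  have h := L.w_mul x x⁻¹ hx (inv_ne_zero hx)
  rw [mul_inv_cancel₀ hx, L.w_one] at h
  omega

lemma w_pow {x : L.D} (hx : x ≠ 0) (n : ℕ) : L.w (x ^ n) = n * L.w x := by
  induction n with
  | zero => simp [L.w_one]
  | succ n ih =>
    rw [pow_succ, L.w_mul _ _ (pow_ne_zero _ hx) hx, ih]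
    push_cast
    ring

lemma w_zpow {x : L.D} (hx : x ≠ 0) (n : ℤ) : L.w (x ^ n) = n * L.w x := by
  obtain ⟨k, rfl | rfl⟩ := n.eq_nat_or_neg
  · rw [zpow_natCast, L.w_pow hx]
  · rw [zpow_neg, zpow_natCast, L.w_inv (pow_ne_zero _ hx), L.w_pow hx]
    ring

lemma w_pi (n : ℤ) : L.w (L.ϖ ^ n) = n := by
  rw [L.w_zpow L.ϖ_ne, L.w_ϖ, mul_one]

lemma pi_ne (n : ℤ) : L.ϖ ^ n ≠ 0 := zpow_ne_zero _ L.ϖ_ne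

lemma pi_mem {n e : ℤ} (h : e ≤ n) : L.ϖ ^ n ∈ L.Ppow e := Or.inr (by rw [L.w_pi]; exact h)

lemma mem_P_iff {x : L.D} (hx : x ≠ 0) {e : ℤ} : x ∈ L.Ppow e ↔ e ≤ L.w x :=
  ⟨fun h => h.resolve_left hx, Or.inr⟩

lemma one_notMem : (1 : L.D) ∉ L.Ppow 1 := by
  rw [L.mem_P_iff one_ne_zero, L.w_one]
  omega

lemma P_inter {x : L.D} (h : ∀ k : ℕ, x ∈ L.Ppow k) : x = 0 := by
  by_contra hx
  have := (L.mem_P_iff hx).1 (h (L.w x + 1).toNat)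
  omega

lemma mem_P_w (x : L.D) : x ∈ L.Ppow (L.w x) := Or.inr le_rfl

/-- right translation by a power of the uniformizer -/
lemma P_mul_pi {x : L.D} {e k : ℤ} : x * L.ϖ ^ k ∈ L.Ppow (e + k) ↔ x ∈ L.Ppow e := by
  by_cases hx : x = 0
  · subst hx; simp [L.Ppow_zero_mem]
  · rw [L.mem_P_iff (mul_ne_zero hx (L.pi_ne k)), L.mem_P_iff hx, L.w_mul _ _ hx (L.pi_ne k),
      L.w_pi]
    omega

lemma P_pi_mul {x : L.D} {e k : ℤ} : L.ϖ ^ k * x ∈ L.Ppow (k + e) ↔ x ∈ L.Ppow e := by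
  by_cases hx : x = 0
  · subst hx; simp [L.Ppow_zero_mem]
  · rw [L.mem_P_iff (mul_ne_zero (L.pi_ne k) hx), L.mem_P_iff hx, L.w_mul _ _ (L.pi_ne k) hx,
      L.w_pi]
    omega

/-- a finite family lies in some power -/
lemma exists_P {κ : Type*} [Finite κ] (x : κ → L.D) : ∃ k : ℕ, ∀ a, x a ∈ L.Ppow (-(k : ℤ)) := by
  cases nonempty_fintype κ
  refine ⟨∑ a, (L.w (x a)).natAbs, fun a => Or.inr ?_⟩
  have := Finset.single_le_sum (f := fun a => (L.w (x a)).natAbs) (fun i _ => Nat.zero_le _)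
    (Finset.mem_univ a)
  omega

end Basics

section Units

variable (L : LocalCSA) {ι : Type} [Fintype ι] [DecidableEq ι]

lemma nrd_ne_of_mul {A B : Matrix ι ι L.D} (h : A * B = 1) : L.nrd A ≠ 0 := by
  intro h0
  have := L.nrd_mul A B
  rw [h, h0, L.nrd_one, zero_mul] at this
  exact one_ne_zero this

lemma exists_inv {A : Matrix ι ι L.D} (h : L.nrd A ≠ 0) : ∃ B, A * B = 1 ∧ B * A = 1 := by
  obtain ⟨u, rfl⟩ := (L.nrd_unit A).1 h
  exact ⟨u⁻¹.val, u.mul_inv, u.inv_mul⟩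

lemma unit_iff (O : Subring (Matrix ι ι L.D)) (a : L.matDot O) :
    IsUnit a ↔ ∃ B ∈ O, a.1 * B = 1 ∧ B * a.1 = 1 := by
  constructor
  · rintro ⟨u, rfl⟩
    refine ⟨(u⁻¹).1.1, (u⁻¹).1.2.1, ?_, ?_⟩
    · exact congrArg Subtype.val u.mul_inv
    · exact congrArg Subtype.val u.inv_mul
  · rintro ⟨B, hB, h1, h2⟩
    let b : L.matDot O := ⟨B, hB, L.nrd_ne_of_mul h2⟩
    exact ⟨⟨a, b, Subtype.ext h1, Subtype.ext h2⟩, rfl⟩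

lemma unit_of_mul_left (O : Subring (Matrix ι ι L.D)) {a b : L.matDot O} (h : IsUnit (a * b)) :
    IsUnit a := by
  rw [unit_iff] at h ⊢
  obtain ⟨B, hB, h1, h2⟩ := h
  have h1' : a.1 * (b.1 * B) = 1 := by rw [← mul_assoc]; exact h1
  exact ⟨b.1 * B, O.mul_mem b.2.1 hB, h1', mul_eq_one_comm.1 h1'⟩

end Units

section Lens

variable {M : Type*} [Monoid M]

lemma hasLen_list (l : List M) (hl : ∀ x ∈ l, IsAtomM x) : HasLen l.prod l.length := by
  refine ⟨1, l.get, isUnit_one, fun i => hl _ (l.get_mem i), ?_⟩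
  rw [List.ofFn_get, one_mul]

lemma hasLen_two_pow {a b : M} (ha : IsAtomM a) (hb : IsAtomM b) (k : ℕ) :
    HasLen (a ^ k * b ^ k) (2 * k) := by
  have := hasLen_list (List.replicate k a ++ List.replicate k b) (by
    intro x hx
    rcases List.mem_append.1 hx with h | h
    · rw [List.eq_of_mem_replicate h]; exact ha
    · rw [List.eq_of_mem_replicate h]; exact hb)
  simpa [two_mul] using this

/-- abstract consequences of the existence of the families of atoms -/
lemma family_consequences (hunit : ∀ a b : M, IsUnit (a * b) → IsUnit a)
    (a a' : ℕ → M) (hat : ∀ k : ℕ, 1 ≤ k → IsAtomM (a k) ∧ IsAtomM (a' k))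
    (hrel : ∀ k : ℕ, 1 ≤ k → a k * a' k = (a 1) ^ k * (a' 1) ^ k) :
    elasticity M = ⊤ ∧ (∀ k : ℕ, 2 ≤ k → refinedElasticity M k = ⊤) ∧
      (∀ k : ℕ, 1 ≤ k → (∀ j : ℕ, 1 ≤ j → 2 * j ∈ lengthUnion M (2 * k)) ∧
        (∀ j : ℕ, 1 ≤ j → 1 + 2 * j ∈ lengthUnion M (2 * k + 1))) := by
  have h2 : ∀ k, 1 ≤ k → 2 ∈ LenSet (a k * a' k) := by
    intro k hk
    have := hasLen_list [a k, a' k] (by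
      intro x hx
      simp only [List.mem_cons, List.not_mem_nil, or_false] at hx
      rcases hx with rfl | rfl
      · exact (hat k hk).1
      · exact (hat k hk).2)
    change HasLen _ _
    simpa using this
  have h2k : ∀ k, 1 ≤ k → 2 * k ∈ LenSet (a k * a' k) := by
    intro k hk
    rw [hrel k hk]
    exact hasLen_two_pow (hat 1 le_rfl).1 (hat 1 le_rfl).2 k
  have hmin : ∀ k, 1 ≤ k → minLen (a k * a' k) ≤ 2 := fun k hk => Nat.sInf_le (h2 k hk)
  have hsup : ∀ k, 1 ≤ k → ((2 * k : ℕ) : ℝ≥0∞) ≤ supLen (a k * a' k) := fun k hk =>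
    le_iSup₂_of_le (f := fun k (_ : k ∈ LenSet _) => (k : ℝ≥0∞)) (2 * k) (h2k k hk) le_rfl
  refine ⟨?_, ?_, ?_⟩
  · refine ENNReal.eq_top_of_forall_nnreal_le fun x => ?_
    obtain ⟨n, hn⟩ := exists_nat_ge x
    refine le_trans ?_ (le_iSup (fun b : M => elastOf b) (a (n + 1) * a' (n + 1)))
    have hnu : ¬ IsUnit (a (n + 1) * a' (n + 1)) := fun h =>
      (hat (n + 1) (by omega)).1.1 (hunit _ _ h)
    rw [elastOf, if_neg hnu]
    have h1 : ((n + 1 : ℕ) : ℝ≥0∞) ≤ supLen (a (n + 1) * a' (n + 1)) /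
        (minLen (a (n + 1) * a' (n + 1)) : ℝ≥0∞) := by
      refine le_trans ?_ (ENNReal.div_le_div (hsup (n + 1) (by omega))
        (Nat.cast_le.2 (hmin (n + 1) (by omega))))
      rw [ENNReal.le_div_iff_mul_le (by simp) (by simp)]
      push_cast
      rw [mul_comm]
    refine le_trans ?_ h1
    have : (x : ℝ≥0∞) ≤ (n : ℝ≥0∞) := by exact_mod_cast hn
    exact this.trans (by exact_mod_cast Nat.le_succ n)
  · intro k hk
    refine ENNReal.eq_top_of_forall_nnreal_le fun x => ?_
    obtain ⟨n, hn⟩ := exists_nat_ge x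
    refine le_trans ?_ (le_iSup₂_of_le (f := fun (b : M) (_ : minLen b ≤ k) => supLen b)
      (a (n + 1) * a' (n + 1)) ((hmin (n + 1) (by omega)).trans hk) le_rfl)
    refine le_trans ?_ (hsup (n + 1) (by omega))
    have : (x : ℝ≥0∞) ≤ (n : ℝ≥0∞) := by exact_mod_cast hn
    exact this.trans (by exact_mod_cast (by omega))
  · -- the element realizing the two lengths
    have key : ∀ k j t : ℕ, 1 ≤ k → k ≤ j →
        ∃ x : M, 2 * k + t ∈ LenSet x ∧ 2 * j + t ∈ LenSet x := by
      intro k j t hk hkj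
      have hA := (hat 1 le_rfl).1
      have hA' := (hat 1 le_rfl).2
      have hj := hat (j - k + 1) (by omega)
      refine ⟨a (j - k + 1) * a' (j - k + 1) * (a 1 ^ (k - 1) * a' 1 ^ (k - 1)) * a 1 ^ t,
        ?_, ?_⟩
      · have := hasLen_list ([a (j - k + 1), a' (j - k + 1)] ++ (List.replicate (k - 1) (a 1) ++
          List.replicate (k - 1) (a' 1)) ++ List.replicate t (a 1)) (by
            intro x hx
            simp only [List.mem_append, List.mem_cons, List.not_mem_nil, or_false,
              List.mem_replicate] at hx
            rcases hx with ((rfl | rfl) | ⟨_, rfl⟩ | ⟨_, rfl⟩) | ⟨_, rfl⟩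
            exacts [hj.1, hj.2, hA, hA', hA])
        have e : ([a (j - k + 1), a' (j - k + 1)] ++ (List.replicate (k - 1) (a 1) ++
          List.replicate (k - 1) (a' 1)) ++ List.replicate t (a 1)).length = 2 * k + t := by
          simp
          omega
        rw [e] at this
        change HasLen _ _
        simpa [mul_assoc] using this
      · rw [hrel (j - k + 1) (by omega)]
        have := hasLen_list ((List.replicate (j - k + 1) (a 1) ++
          List.replicate (j - k + 1) (a' 1)) ++ (List.replicate (k - 1) (a 1) ++
          List.replicate (k - 1) (a' 1)) ++ List.replicate t (a 1)) (by
            intro x hx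
            simp only [List.mem_append, List.mem_replicate] at hx
            rcases hx with ((⟨_, rfl⟩ | ⟨_, rfl⟩) | ⟨_, rfl⟩ | ⟨_, rfl⟩) | ⟨_, rfl⟩
            exacts [hA, hA', hA, hA', hA])
        have e : ((List.replicate (j - k + 1) (a 1) ++
          List.replicate (j - k + 1) (a' 1)) ++ (List.replicate (k - 1) (a 1) ++
          List.replicate (k - 1) (a' 1)) ++ List.replicate t (a 1)).length = 2 * j + t := by
          simp
          omega
        rw [e] at this
        change HasLen _ _
        simpa [mul_assoc] using this
    have key2 : ∀ k j t : ℕ, 1 ≤ k → 1 ≤ j → 2 * j + t ∈ lengthUnion M (2 * k + t) := by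
      intro k j t hk hj
      rcases le_total k j with h | h
      · exact key k j t hk h
      · obtain ⟨x, h1, h2⟩ := key j k t hj h
        exact ⟨x, h2, h1⟩
    intro k hk
    refine ⟨fun j hj => key2 k j 0 hk hj, fun j hj => ?_⟩
    rw [add_comm 1]
    exact key2 k j 1 hk hj

/-- A length function bounded on atoms bounds the elasticity. -/
lemma elasticity_lt_top (lam : M → ℕ) (hmul : ∀ a b, lam (a * b) = lam a + lam b)
    (hunit : ∀ a, IsUnit a → lam a = 0) (hpos : ∀ a, ¬ IsUnit a → 1 ≤ lam a) (N : ℕ)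
    (hN : ∀ a, IsAtomM a → lam a ≤ N) : elasticity M < ⊤ := by
  have hlist : ∀ l : List M, (∀ x ∈ l, IsAtomM x) →
      l.length ≤ lam l.prod ∧ lam l.prod ≤ N * l.length := by
    intro l
    induction l with
    | nil => intro _; simp [hunit 1 isUnit_one]
    | cons x l ih =>
      intro h
      have h1 := ih fun y hy => h y (List.mem_cons_of_mem _ hy)
      have hx := h x List.mem_cons_self
      have h2 := hpos x hx.1
      have h3 := hN x hx
      rw [List.prod_cons, hmul, List.length_cons]
      constructor
      · omega
      · rw [mul_add]; omega
  have hlen : ∀ a k, HasLen a k → k ≤ lam a ∧ lam a ≤ N * k := by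
    rintro a k ⟨ε, u, hε, hu, rfl⟩
    have := hlist (List.ofFn u) (by
      intro x hx
      obtain ⟨i, rfl⟩ := (List.mem_ofFn' u x).1 hx
      exact hu i)
    rw [hmul, hunit ε hε, zero_add]
    simpa using this
  have hbd : elasticity M ≤ max 1 (N : ℝ≥0∞) := by
    refine iSup_le fun a => ?_
    rw [elastOf]
    split_ifs with h
    · exact le_max_left _ _
    · refine le_trans ?_ (le_max_right _ _)
      refine ENNReal.div_le_of_le_mul ?_
      refine iSup₂_le fun k hk => ?_
      have hm : minLen a ∈ LenSet a := Nat.sInf_mem ⟨k, hk⟩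
      have h1 := (hlen a k hk).1
      have h2 := (hlen a _ hm).2
      exact_mod_cast h1.trans h2
  refine lt_of_le_of_lt hbd ?_
  simp

end Lens

end LocalCSA

end Paper

namespace Paper

namespace LocalCSA

section General

lemma projective_of_ses {R N : Type*} [Ring R] [AddCommGroup N] [Module R N]
    (J : Submodule R N) (ψ : N →ₗ[R] N) (h1 : Module.Projective R (J.map ψ))
    (h2 : Module.Projective R (J ⊓ LinearMap.ker ψ : Submodule R N)) : Module.Projective R J := by
  have hφ : Function.Surjective (ψ.submoduleMap J) := ψ.submoduleMap_surjective J
  obtain ⟨s, hs⟩ := Module.projective_lifting_property (ψ.submoduleMap J) LinearMap.id hφ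
  have hs' : ∀ z, ψ.submoduleMap J (s z) = z := fun z => congrArg (fun g => g z) hs
  let inc1 : J →ₗ[R] (J ⊓ LinearMap.ker ψ : Submodule R N) :=
    (J.subtype.comp (LinearMap.id - s.comp (ψ.submoduleMap J))).codRestrict _ (by
      intro y
      refine ⟨(y - s (ψ.submoduleMap J y)).2, ?_⟩
      have h3 : ψ.submoduleMap J (y - s (ψ.submoduleMap J y)) = 0 := by
        rw [map_sub, hs', sub_self]
      exact congrArg Subtype.val h3)
  refine Module.Projective.of_split (inc1.prod (ψ.submoduleMap J))
    ((Submodule.inclusion inf_le_left).coprod s) ?_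
  ext y
  change ((y - s (ψ.submoduleMap J y) : J) : N) + (s (ψ.submoduleMap J y) : J) = y
  simp

end General

section Hereditary

open MulOpposite

variable (L : LocalCSA) {ι : Type} [Fintype ι] [DecidableEq ι] {r : ℕ}
  {m : Fin r → Fin r → ℤ} {β : ι → Fin r}
  {O : Subring (Matrix ι ι L.D)}

lemma single_mem (hO : ∀ B, B ∈ O ↔ ∀ a b, B a b ∈ L.Ppow (m (β a) (β b)))
    {p q : ι} {x : L.D} (hx : x ∈ L.Ppow (m (β p) (β q))) :
    Matrix.single p q x ∈ O := by
  rw [hO]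
  intro a b
  rw [Matrix.single_apply]
  split_ifs with h
  · rw [← h.1, ← h.2]; exact hx
  · exact L.Ppow_zero_mem _

lemma not_hereditary (hO : ∀ B, B ∈ O ↔ ∀ a b, B a b ∈ L.Ppow (m (β a) (β b)))
    (h0 : ∀ i, m i i = 0)
    {p q : ι} (hs : 2 ≤ m (β p) (β q) + m (β q) (β p))
    (hh : IsHereditaryRing O) : False := by
  set s := m (β p) (β q) + m (β q) (β p) with hs'
  let x : O := ⟨Matrix.single p p (L.ϖ ^ (s - 1)), L.single_mem hO (L.pi_mem (by rw [h0]; omega))⟩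
  let y : O := ⟨Matrix.single p q (L.ϖ ^ (m (β p) (β q))), L.single_mem hO (L.pi_mem le_rfl)⟩
  let A1 : O := ⟨Matrix.single p q (L.ϖ ^ (m (β p) (β q))), L.single_mem hO (L.pi_mem le_rfl)⟩
  let A2 : O := ⟨Matrix.single q q (L.ϖ ^ (s - 1)), L.single_mem hO (L.pi_mem (by rw [h0]; omega))⟩
  have hxy : x * A1 = y * A2 := by
    apply Subtype.ext
    change Matrix.single p p _ * Matrix.single p q _ = Matrix.single p q _ * Matrix.single q q _
    rw [Matrix.single_mul_single_same, Matrix.single_mul_single_same, ← zpow_add₀ L.ϖ_ne,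
      ← zpow_add₀ L.ϖ_ne, add_comm]
  let J : Submodule Oᵐᵒᵖ O := Submodule.span Oᵐᵒᵖ {x, y}
  have hxJ : x ∈ J := Submodule.subset_span (by simp)
  have hyJ : y ∈ J := Submodule.subset_span (by simp)
  have hproj : Module.Projective Oᵐᵒᵖ J := hh J
  let f : (Oᵐᵒᵖ × Oᵐᵒᵖ) →ₗ[Oᵐᵒᵖ] J :=
    (LinearMap.toSpanSingleton Oᵐᵒᵖ J ⟨x, hxJ⟩).coprod (LinearMap.toSpanSingleton Oᵐᵒᵖ J ⟨y, hyJ⟩)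
  have hf : Function.Surjective f := by
    rintro ⟨z, hz⟩
    obtain ⟨a, b, rfl⟩ := Submodule.mem_span_pair.1 hz
    exact ⟨(a, b), by simp [f]⟩
  obtain ⟨g, hg⟩ := Module.projective_lifting_property f LinearMap.id hf
  have hgx : f (g ⟨x, hxJ⟩) = ⟨x, hxJ⟩ := congrArg (fun φ => φ ⟨x, hxJ⟩) hg
  have hrel : op A1 • g ⟨x, hxJ⟩ = op A2 • g ⟨y, hyJ⟩ := by
    rw [← map_smul, ← map_smul]
    congr 1
    exact Subtype.ext hxy
  rcases hX : g ⟨x, hxJ⟩ with ⟨X1, X2⟩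
  rcases hY : g ⟨y, hyJ⟩ with ⟨Y1, Y2⟩
  rw [hX] at hgx hrel
  rw [hY] at hrel
  have hrel1 : (unop X1 : O) * A1 = unop Y1 * A2 := by
    have := congrArg (fun z => unop (Prod.fst z)) hrel
    exact this
  have hx1 : x * unop X1 + y * unop X2 = x := by
    have := congrArg Subtype.val hgx
    simpa [f] using this
  have e1 : (unop X1).1 p p * L.ϖ ^ (m (β p) (β q)) = (unop Y1).1 p q * L.ϖ ^ (s - 1) := by
    have := congrArg (fun z : O => z.1 p q) hrel1
    simpa [A1, A2] using this
  have e2 : L.ϖ ^ (s - 1) * (unop X1).1 p p + L.ϖ ^ (m (β p) (β q)) * (unop X2).1 q p =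
      L.ϖ ^ (s - 1) := by
    have := congrArg (fun z : O => z.1 p p) hx1
    simpa [x, y] using this
  have k1 : (unop X1).1 p p ∈ L.Ppow (s - 1) := by
    rw [← L.P_mul_pi (k := m (β p) (β q)), e1, add_comm]
    exact L.P_mul_pi.2 ((hO _).1 (unop Y1).2 p q)
  have k2 : L.ϖ ^ (s - 1) ∈ L.Ppow s := by
    rw [← e2]
    refine L.Ppow_add_mem (L.Pmul_le (L.pi_mem le_rfl) k1 (by omega)) ?_
    exact L.Pmul_le (L.pi_mem le_rfl) ((hO _).1 (unop X2).2 q p) le_rfl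
  rw [L.mem_P_iff (L.pi_ne _), L.w_pi] at k2
  omega

lemma row_projective (hO : ∀ B, B ∈ O ↔ ∀ a b, B a b ∈ L.Ppow (m (β a) (β b)))
    (h0 : ∀ i, m i i = 0) (htri : ∀ i j k, m i k ≤ m i j + m j k)
    (h1 : ∀ i j, m i j + m j i ≤ 1) (a : ι)
    (J : Submodule Oᵐᵒᵖ O)
    (hJ : ∀ x ∈ J, ∀ i j, i ≠ a → x.1 i j = 0) :
    Module.Projective Oᵐᵒᵖ J := by
  by_cases hbot : ∀ x ∈ J, x = 0
  · have : Subsingleton J := ⟨fun x y => Subtype.ext (by rw [hbot x x.2, hbot y y.2])⟩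
    infer_instance
  push Not at hbot
  obtain ⟨x0, hx0, hne⟩ := hbot
  let T : Set (O × ι) := {z | z.1 ∈ J ∧ z.1.1 a z.2 ≠ 0}
  have hT : T.Nonempty := by
    by_contra hcon
    apply hne
    apply Subtype.ext
    ext i j
    by_cases hi : i = a
    · subst hi
      by_contra hh
      exact hcon ⟨(x0, j), hx0, hh⟩
    · exact hJ x0 hx0 i j hi
  let ht : O × ι → ℕ := fun z => (∑ d, (L.w (z.1.1 a z.2) + m (β z.2) (β d) - m (β a) (β d))).toNat
  obtain ⟨⟨x, c⟩, ⟨hxJ, hxc⟩, hmin⟩ := (measure ht).wf.has_min T hT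
  simp only at hxJ hxc
  have hnn : ∀ z ∈ T, ∀ d, 0 ≤ L.w (z.1.1 a z.2) + m (β z.2) (β d) - m (β a) (β d) := by
    intro z hz d
    have k1 := (L.mem_P_iff hz.2).1 ((hO _).1 z.1.2 a z.2)
    have k2 := htri (β a) (β z.2) (β d)
    omega
  have hdom : ∀ y ∈ J, ∀ b, y.1 a b ≠ 0 → L.w (x.1 a c) + m (β c) (β b) ≤ L.w (y.1 a b) := by
    intro y hy b hb
    by_contra hlt
    push Not at hlt
    have k1 := h1 (β c) (β b)
    have hle : ∀ d, L.w (y.1 a b) + m (β b) (β d) ≤ L.w (x.1 a c) + m (β c) (β d) := by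
      intro d
      have := htri (β b) (β c) (β d)
      omega
    have hm := hmin (y, b) ⟨hy, hb⟩
    apply hm
    change ht (y, b) < ht (x, c)
    have hlt' : ∑ d, (L.w (y.1 a b) + m (β b) (β d) - m (β a) (β d)) <
        ∑ d, (L.w (x.1 a c) + m (β c) (β d) - m (β a) (β d)) := by
      refine Finset.sum_lt_sum (fun d _ => by have := hle d; omega) ⟨b, Finset.mem_univ _, ?_⟩
      rw [h0]
      omega
    have hnn' := Finset.sum_nonneg fun d (_ : d ∈ Finset.univ) => hnn (y, b) ⟨hy, hb⟩ d
    simp only [ht]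
    simp only at hnn'
    omega
  have hz : Matrix.single a c (x.1 a c) ∈ O := L.single_mem hO ((hO _).1 x.2 a c)
  have hzJ : (⟨_, hz⟩ : O) ∈ J := by
    have hE : Matrix.single c c (1 : L.D) ∈ O :=
      L.single_mem hO (L.Ppow_one_mem (le_of_eq (h0 _)))
    have := J.smul_mem (op (⟨_, hE⟩ : O)) hxJ
    convert this using 1
    apply Subtype.ext
    change Matrix.single a c (x.1 a c) = x.1 * Matrix.single c c (1 : L.D)
    ext i j
    by_cases hj : c = j
    · subst hj
      by_cases hi : a = i
      · subst hi; simp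
      · rw [Matrix.single_apply_of_row_ne hi]
        simp [hJ x hxJ i c (Ne.symm hi)]
    · rw [Matrix.single_apply_of_col_ne _ _ hj, Matrix.mul_single_apply_of_ne _ _ _ _ _ (Ne.symm hj)]
  have hi : ∀ y : J, Matrix.single c a (x.1 a c)⁻¹ * y.1.1 ∈ O := by
    intro y
    rw [hO]
    intro i j
    by_cases hi : i = c
    · subst hi
      rw [Matrix.single_mul_apply_same]
      by_cases hy : y.1.1 a j = 0
      · rw [hy, mul_zero]; exact L.Ppow_zero_mem _
      · have := hdom y.1 y.2 j hy
        exact L.Pmul_le (L.mem_P_w _) (L.mem_P_w _) (by rw [L.w_inv hxc]; omega)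
    · rw [Matrix.single_mul_apply_of_ne _ _ _ _ _ hi]; exact L.Ppow_zero_mem _
  let inc : J →ₗ[Oᵐᵒᵖ] Oᵐᵒᵖ :=
    { toFun := fun y => op ⟨_, hi y⟩
      map_add' := by
        intro y y'
        rw [← op_add]
        congr 1
        apply Subtype.ext
        exact mul_add _ _ _
      map_smul' := by
        intro t y
        apply unop_injective
        apply Subtype.ext
        exact (mul_assoc _ _ _).symm }
  refine Module.Projective.of_split inc (LinearMap.toSpanSingleton Oᵐᵒᵖ J ⟨_, hzJ⟩) ?_
  ext y i j
  change (Matrix.single a c (x.1 a c) * (Matrix.single c a (x.1 a c)⁻¹ * y.1.1)) i j = y.1.1 i j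
  rw [← mul_assoc, Matrix.single_mul_single_same, mul_inv_cancel₀ hxc]
  by_cases hia : i = a
  · subst hia; simp
  · rw [Matrix.single_mul_apply_of_ne _ _ _ _ _ hia, hJ y.1 y.2 i j hia]

lemma projective_of_rows (hO : ∀ B, B ∈ O ↔ ∀ a b, B a b ∈ L.Ppow (m (β a) (β b)))
    (h0 : ∀ i, m i i = 0) (htri : ∀ i j k, m i k ≤ m i j + m j k)
    (h1 : ∀ i j, m i j + m j i ≤ 1) (T : Finset ι) :
    ∀ J : Submodule Oᵐᵒᵖ O,
    (∀ x ∈ J, ∀ i j, i ∉ T → x.1 i j = 0) →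
    Module.Projective Oᵐᵒᵖ J := by
  induction T using Finset.induction_on with
  | empty =>
    intro J hJ
    have : Subsingleton J := ⟨fun x y => by
      apply Subtype.ext; apply Subtype.ext; ext i j
      rw [hJ x x.2 i j (by simp), hJ y y.2 i j (by simp)]⟩
    infer_instance
  | insert a T ha ih =>
    intro J hJ
    have hE : Matrix.single a a (1 : L.D) ∈ O :=
      L.single_mem hO (L.Ppow_one_mem (le_of_eq (h0 _)))
    let ψ : O →ₗ[Oᵐᵒᵖ] O := LinearMap.mulLeft Oᵐᵒᵖ (⟨_, hE⟩ : O)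
    have hψ : ∀ y i j, (ψ y).1 i j = if i = a then y.1 i j else 0 := by
      intro y i j
      change (Matrix.single a a (1 : L.D) * y.1) i j = _
      split_ifs with h
      · subst h; simp
      · rw [Matrix.single_mul_apply_of_ne _ _ _ _ _ h]
    refine projective_of_ses J ψ ?_ ?_
    · refine L.row_projective hO h0 htri h1 a _ ?_
      rintro _ ⟨y, hy, rfl⟩ i j hi
      rw [hψ, if_neg hi]
    · refine ih _ ?_
      rintro y ⟨hy, hy0⟩ i j hi
      by_cases hia : i = a
      · have h2 : (ψ y).1 i j = 0 := by
          have h4 : ψ y = 0 := hy0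
          rw [h4]; rfl
        rw [hψ, if_pos hia] at h2
        exact h2
      · exact hJ y hy i j (by simp [hia, hi])

lemma hereditary_iff (hO : ∀ B, B ∈ O ↔ ∀ a b, B a b ∈ L.Ppow (m (β a) (β b)))
    (h0 : ∀ i, m i i = 0) (htri : ∀ i j k, m i k ≤ m i j + m j k)
    (hpos : ∀ i j, i ≠ j → 0 < m i j + m j i) (hβ : Function.Surjective β) :
    (∀ i j, i ≠ j → m i j + m j i = 1) ↔ IsHereditaryRing O := by
  constructor
  · intro h J
    refine L.projective_of_rows hO h0 htri (fun i j => ?_) Finset.univ J (fun x _ i j hi => by simp at hi)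
    by_cases hij : i = j
    · subst hij; simp [h0]
    · exact le_of_eq (h i j hij)
  · intro h i j hij
    by_contra hne
    obtain ⟨p, rfl⟩ := hβ i
    obtain ⟨q, rfl⟩ := hβ j
    have := hpos _ _ hij
    exact L.not_hereditary hO h0 (p := p) (q := q) (by omega) h

end Hereditary

end LocalCSA

end Paper

namespace Paper

namespace LocalCSA

section Residue

variable (L : LocalCSA) {κ : Type} [Fintype κ] [DecidableEq κ]

/-- all entries of a matrix lie in `𝔓^e` -/
def EntP (e : ℤ) (M : Matrix κ κ L.D) : Prop := ∀ a b, M a b ∈ L.Ppow e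

/-- non-singularity modulo `𝔓` (on row vectors) -/
def NS (M : Matrix κ κ L.D) : Prop :=
  ∀ ξ : κ → L.D, (∀ a, ξ a ∈ L.Ppow 0) → (∀ b, ∑ a, ξ a * M a b ∈ L.Ppow 1) →
    ∀ a, ξ a ∈ L.Ppow 1

variable {L}

lemma EntP.mul {s t e : ℤ} {A B : Matrix κ κ L.D} (hA : EntP L s A) (hB : EntP L t B)
    (h : e ≤ s + t) : EntP L e (A * B) := fun a b => by
  rw [Matrix.mul_apply]
  exact L.Psum_mem _ _ fun c _ => L.Pmul_le (hA a c) (hB c b) h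

lemma EntP.add {e : ℤ} {A B : Matrix κ κ L.D} (hA : EntP L e A) (hB : EntP L e B) :
    EntP L e (A + B) := fun a b => L.Ppow_add_mem (hA a b) (hB a b)

lemma EntP.sub {e : ℤ} {A B : Matrix κ κ L.D} (hA : EntP L e A) (hB : EntP L e B) :
    EntP L e (A - B) := fun a b => L.Psub_mem (hA a b) (hB a b)

lemma EntP.one : EntP L 0 (1 : Matrix κ κ L.D) := fun a b => by
  rw [Matrix.one_apply]
  split_ifs
  · exact L.Ppow_one_mem le_rfl
  · exact L.Ppow_zero_mem _

lemma EntP.single {e : ℤ} (a b : κ) {x : L.D} (hx : x ∈ L.Ppow e) :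
    EntP L e (Matrix.single a b x) := fun c d => by
  rw [Matrix.single_apply]
  split_ifs
  · exact hx
  · exact L.Ppow_zero_mem _

lemma near_one {G : Matrix κ κ L.D} (hG : EntP L 1 (G - 1)) (e : ℤ) (x : κ → L.D)
    (hx : ∀ b, ∑ a, x a * G a b ∈ L.Ppow e) : ∀ a, x a ∈ L.Ppow e := by
  have step : ∀ k : ℕ, (∀ a, x a ∈ L.Ppow (e - k)) → ∀ a, x a ∈ L.Ppow e := by
    intro k
    induction k with
    | zero => intro h a; simpa using h a
    | succ k ih =>
      intro h
      apply ih
      intro b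
      have e1 : x b = ∑ a, x a * G a b - ∑ a, x a * (G - 1) a b := by
        rw [← Finset.sum_sub_distrib]
        simp [mul_sub, Matrix.one_apply]
      rw [e1]
      refine L.Psub_mem (L.Ppow_mono (by omega) (hx b)) (L.Psum_mem _ _ fun a _ => ?_)
      exact L.Pmul_le (h a) (hG a b) (by push_cast; omega)
  obtain ⟨K, hK⟩ := L.exists_P x
  exact step (e + K).toNat fun a => L.Ppow_mono (by omega) (hK a)

lemma near_one_inv {G : Matrix κ κ L.D} (hG : EntP L 1 (G - 1)) :
    ∃ V, EntP L 0 V ∧ G * V = 1 ∧ V * G = 1 := by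
  have hinj : Function.Injective (Matrix.vecMulLinear G : (κ → L.D) →ₗ[L.D] (κ → L.D)) := by
    rw [injective_iff_map_eq_zero]
    intro x hx
    funext a
    refine L.P_inter fun k => near_one hG k x (fun b => ?_) a
    have : ∑ a, x a * G a b = 0 := congrFun hx b
    rw [this]
    exact L.Ppow_zero_mem _
  have hsur := LinearMap.surjective_of_injective hinj
  choose V hV using fun q : κ => hsur (fun b => (1 : Matrix κ κ L.D) q b)
  have hVG : ∀ q b, ∑ a, V q a * G a b = (1 : Matrix κ κ L.D) q b := fun q b => congrFun (hV q) b
  have h1 : (Matrix.of V) * G = 1 := by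
    ext q b
    exact hVG q b
  refine ⟨Matrix.of V, fun q a => ?_, mul_eq_one_comm.1 h1, h1⟩
  refine near_one hG 0 (V q) (fun b => ?_) a
  rw [hVG]
  exact EntP.one q b

lemma NS_of_mul {M N : Matrix κ κ L.D} (hM : EntP L 0 M) (h : EntP L 1 (M * N - 1)) : NS L N := by
  obtain ⟨V, hV, h1, -⟩ := near_one_inv h
  have h2 : N * V * M = 1 := by
    rw [mul_assoc] at h1
    exact mul_eq_one_comm.1 h1
  intro ξ hξ hN a
  have e1 : ξ a = ∑ b, (∑ c, ξ c * N c b) * (V * M) b a := by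
    have e2 : Matrix.vecMul (Matrix.vecMul ξ N) (V * M) = ξ := by
      rw [Matrix.vecMul_vecMul, ← mul_assoc, h2, Matrix.vecMul_one]
    exact (congrFun e2 a).symm
  rw [e1]
  exact L.Psum_mem _ _ fun b _ => L.Pmul_le (hN b) (hV.mul hM (e := 0) (by omega) b a) (by omega)

lemma NS_of_col {M N : Matrix κ κ L.D} (hM : EntP L 0 M) (hN : EntP L 0 N) (i : κ)
    (h : EntP L 1 (M * N - (1 - Matrix.single i i 1))) {a : κ} (ha : N a i ∉ L.Ppow 1) :
    NS L N := by
  have hne : N a i ≠ 0 := fun h => ha (Or.inl h)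
  have hw : L.w (N a i) = 0 := by
    have k1 := (L.mem_P_iff hne).1 (hN a i)
    rw [L.mem_P_iff hne] at ha
    omega
  have hu : (N a i)⁻¹ ∈ L.Ppow 0 := Or.inr (by rw [L.w_inv hne]; omega)
  set p := M * N - (1 - Matrix.single i i 1) with hp
  have hMN : M * N = (1 - Matrix.single i i 1) + p := by rw [hp]; abel
  have hS : EntP L 0 (Matrix.single i a (N a i)⁻¹) := EntP.single i a hu
  refine NS_of_mul (M := M + Matrix.single i a (N a i)⁻¹ * (1 - N * M)) ?_ ?_
  · exact hM.add (hS.mul (EntP.one.sub (hN.mul hM (e := 0) (by omega))) (by omega))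
  · have hS2 : Matrix.single i a (N a i)⁻¹ * N * Matrix.single i i 1 = Matrix.single i i 1 := by
      rw [mul_assoc]
      ext c d
      by_cases hc : c = i
      · subst hc
        rw [Matrix.single_mul_apply_same]
        by_cases hd : d = c
        · subst hd; simp [hne]
        · rw [Matrix.mul_single_apply_of_ne _ _ _ _ _ hd, mul_zero,
            Matrix.single_apply_of_col_ne _ _ (Ne.symm hd)]
      · rw [Matrix.single_mul_apply_of_ne _ _ _ _ _ hc, Matrix.single_apply_of_row_ne (Ne.symm hc)]
    have e1 : (M + Matrix.single i a (N a i)⁻¹ * (1 - N * M)) * N - 1 =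
        p - Matrix.single i a (N a i)⁻¹ * N * p := by
      have e2 : (M + Matrix.single i a (N a i)⁻¹ * (1 - N * M)) * N =
          M * N + (Matrix.single i a (N a i)⁻¹ * N - Matrix.single i a (N a i)⁻¹ * N * (M * N)) := by
        noncomm_ring
      rw [e2, hMN]
      have e3 : Matrix.single i a (N a i)⁻¹ * N * (1 - Matrix.single i i 1 + p) =
          Matrix.single i a (N a i)⁻¹ * N - Matrix.single i i 1 +
            Matrix.single i a (N a i)⁻¹ * N * p := by
        rw [mul_add, mul_sub, mul_one, hS2]
      rw [e3]
      abel
    rw [e1]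
    exact h.sub ((hS.mul hN (e := 0) (by omega)).mul h (by omega))

lemma row_of_not_NS {M N : Matrix κ κ L.D} (hN : EntP L 0 N) (i : κ)
    (hM : EntP L 0 M)
    (h : EntP L 1 (M * N - (1 - Matrix.single i i 1))) (hns : ¬ NS L M) (b : κ) :
    M i b ∈ L.Ppow 1 := by
  unfold NS at hns
  push Not at hns
  obtain ⟨ξ, hξ, hξM, a, ha⟩ := hns
  have h1 : ∀ c, c ≠ i → ξ c ∈ L.Ppow 1 := by
    intro c hc
    have e2 : ξ c = ∑ b, (∑ d, ξ d * M d b) * N b c -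
        ∑ d, ξ d * (M * N - (1 - Matrix.single i i 1) : Matrix κ κ L.D) d c := by
      have e3 : ∑ b, (∑ d, ξ d * M d b) * N b c = ∑ d, ξ d * (M * N) d c := by
        exact congrFun (Matrix.vecMul_vecMul ξ M N) c
      rw [e3, ← Finset.sum_sub_distrib]
      have e4 : ∀ d, Matrix.single i i (1 : L.D) d c = 0 := fun d =>
        Matrix.single_apply_of_col_ne _ _ (Ne.symm hc) _
      simp [mul_sub, Matrix.one_apply, e4]
    rw [e2]
    refine L.Psub_mem (L.Psum_mem _ _ fun b _ => L.Pmul_le (hξM b) (hN b c) (by omega))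
      (L.Psum_mem _ _ fun d _ => L.Pmul_le (hξ d) (h d c) (by omega))
  have hi : ξ i ∉ L.Ppow 1 := by
    intro hi
    by_cases hai : a = i
    · subst hai; exact ha hi
    · exact ha (h1 a hai)
  have hne : ξ i ≠ 0 := fun h => hi (Or.inl h)
  have hw : L.w (ξ i) = 0 := by
    have k1 := (L.mem_P_iff hne).1 (hξ i)
    rw [L.mem_P_iff hne] at hi
    omega
  have e5 : ξ i * M i b ∈ L.Ppow 1 := by
    have e6 : ξ i * M i b = ∑ d, ξ d * M d b - ∑ d ∈ Finset.univ.erase i, ξ d * M d b := by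
      rw [← Finset.add_sum_erase _ _ (Finset.mem_univ i)]
      abel
    rw [e6]
    refine L.Psub_mem (hξM b) (L.Psum_mem _ _ fun d hd => ?_)
    exact L.Pmul_le (h1 d (Finset.ne_of_mem_erase hd)) (hM d b) (by omega)
  have e7 : M i b = (ξ i)⁻¹ * (ξ i * M i b) := by rw [← mul_assoc, inv_mul_cancel₀ hne, one_mul]
  rw [e7]
  exact L.Pmul_le (L.mem_P_w _) e5 (by rw [L.w_inv hne]; omega)

lemma not_both_NS {M N : Matrix κ κ L.D} (hM : EntP L 0 M) (i : κ)
    (h : EntP L 1 (M * N - (1 - Matrix.single i i 1))) (h1 : NS L M) (h2 : NS L N) : False := by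
  have k1 : ∀ a, M i a ∈ L.Ppow 1 := by
    refine h2 (fun a => M i a) (hM i) fun b => ?_
    have := h i b
    have e : (M * N - (1 - Matrix.single i i 1) : Matrix κ κ L.D) i b = ∑ a, M i a * N a b := by
      rw [Matrix.sub_apply, Matrix.sub_apply, Matrix.mul_apply, Matrix.one_apply,
        Matrix.single_apply]
      simp
    rwa [e] at this
  have k2 := h1 (fun a => (1 : Matrix κ κ L.D) i a) (fun a => EntP.one i a) (fun b => by
    simpa [Matrix.one_apply] using k1 b) i
  rw [Matrix.one_apply_eq] at k2
  exact L.one_notMem k2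

end Residue

end LocalCSA

end Paper

namespace Paper

namespace LocalCSA

section AtomsNonHereditary

variable {L : LocalCSA} {r : ℕ} {nv : Fin r → ℕ} {m : Fin r → Fin r → ℤ}

lemma NS_left_of_mul {κ : Type} [Fintype κ] [DecidableEq κ] {M N : Matrix κ κ L.D}
    (hN : EntP L 0 N) (h : EntP L 1 (M * N - 1)) : NS L M := by
  obtain ⟨V, hV, h1, -⟩ := near_one_inv h
  have h2 : M * (N * V) = 1 := by rw [← mul_assoc]; exact h1
  intro ξ hξ hM a
  have e1 : ξ a = ∑ b, (∑ c, ξ c * M c b) * (N * V) b a := by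
    have e2 : Matrix.vecMul (Matrix.vecMul ξ M) (N * V) = ξ := by
      rw [Matrix.vecMul_vecMul, h2, Matrix.vecMul_one]
    exact (congrFun e2 a).symm
  rw [e1]
  exact L.Psum_mem _ _ fun b _ => L.Pmul_le (hM b) (hN.mul hV (e := 0) (by omega) b a) (by omega)

/-- diagonal blocks -/
def blk (l : Fin r) (B : Matrix (BlockIdx nv) (BlockIdx nv) L.D) :
    Matrix (Fin (nv l)) (Fin (nv l)) L.D := fun x y => B ⟨l, x⟩ ⟨l, y⟩

lemma blk_int (h0 : ∀ i, m i i = 0) {B : Matrix (BlockIdx nv) (BlockIdx nv) L.D}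
    (hB : ∀ a b, B a b ∈ L.Ppow (m a.1 b.1)) (l : Fin r) : EntP L 0 (blk l B) := fun x y => by
  have := hB ⟨l, x⟩ ⟨l, y⟩
  rwa [h0] at this

lemma blk_mul (hpos : ∀ i j, i ≠ j → 0 < m i j + m j i)
    {B C : Matrix (BlockIdx nv) (BlockIdx nv) L.D}
    (hB : ∀ a b, B a b ∈ L.Ppow (m a.1 b.1)) (hC : ∀ a b, C a b ∈ L.Ppow (m a.1 b.1))
    (l : Fin r) : EntP L 1 (blk l (B * C) - blk l B * blk l C) := fun x y => by
  have e : (blk l (B * C) - blk l B * blk l C) x y =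
      ∑ l' ∈ Finset.univ.erase l, ∑ z, B ⟨l, x⟩ ⟨l', z⟩ * C ⟨l', z⟩ ⟨l, y⟩ := by
    rw [Matrix.sub_apply, Matrix.mul_apply]
    have : blk l (B * C) x y = ∑ l', ∑ z, B ⟨l, x⟩ ⟨l', z⟩ * C ⟨l', z⟩ ⟨l, y⟩ := by
      unfold blk
      rw [Matrix.mul_apply, Fintype.sum_sigma]
    rw [this, ← Finset.add_sum_erase _ _ (Finset.mem_univ l)]
    simp [blk]
  rw [e]
  refine L.Psum_mem _ _ fun l' hl' => L.Psum_mem _ _ fun z _ => L.Pmul_le (hB _ _) (hC _ _) ?_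
  have := hpos l l' (Finset.ne_of_mem_erase hl').symm
  simp only
  omega

lemma propagate (htri : ∀ i j k, m i k ≤ m i j + m j k)
    (hpos : ∀ i j, i ≠ j → 0 < m i j + m j i) {C : Matrix (BlockIdx nv) (BlockIdx nv) L.D}
    (hC : ∀ a b, C a b ∈ L.Ppow (m a.1 b.1)) (y : BlockIdx nv → L.D) (g : Fin r → ℤ)
    (hy : ∀ c, y c ∈ L.Ppow (g c.1)) (hg : ∀ l l', g l ≤ g l' + m l' l) (S : Set (Fin r))
    (hNS : ∀ l ∈ S, NS L (blk l C))
    (hyC : ∀ l ∈ S, ∀ x, ∑ c, y c * C c ⟨l, x⟩ ∈ L.Ppow (g l + 1))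
    (hS : ∀ l ∈ S, ∀ l' ∉ S, (∀ x, y ⟨l', x⟩ ∈ L.Ppow (g l' + 1)) ∨ g l < g l' + m l' l) :
    ∀ l ∈ S, ∀ x, y ⟨l, x⟩ ∈ L.Ppow (g l + 1) := by
  let R : Fin r → Fin r → Prop := fun l' l => l' ≠ l ∧ g l = g l' + m l' l
  have : IsTrans (Fin r) R := ⟨fun a b c h1 h2 => by
    have k1 := hg c a
    have k2 := htri a b c
    have k3 := h1.2
    have k4 := h2.2
    refine ⟨fun h => ?_, by omega⟩
    subst h
    have := hpos a b h1.1
    omega⟩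
  have : Std.Irrefl R := ⟨fun a h => h.1 rfl⟩
  have hwf : WellFounded R := Finite.wellFounded_of_trans_of_irrefl R
  intro l
  induction l using hwf.induction with
  | _ l ih =>
  intro hl
  have key : ∀ b, ∑ x, y ⟨l, x⟩ * C ⟨l, x⟩ ⟨l, b⟩ ∈ L.Ppow (g l + 1) := by
    intro b
    have e : ∑ x, y ⟨l, x⟩ * C ⟨l, x⟩ ⟨l, b⟩ = ∑ c, y c * C c ⟨l, b⟩ -
        ∑ l' ∈ Finset.univ.erase l, ∑ x, y ⟨l', x⟩ * C ⟨l', x⟩ ⟨l, b⟩ := by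
      rw [Fintype.sum_sigma, ← Finset.add_sum_erase _ _ (Finset.mem_univ l)]
      abel
    rw [e]
    refine L.Psub_mem (hyC l hl b) (L.Psum_mem _ _ fun l' hl' => L.Psum_mem _ _ fun x _ => ?_)
    have hne := Finset.ne_of_mem_erase hl'
    by_cases hlt : g l < g l' + m l' l
    · exact L.Pmul_le (hy _) (hC _ _) (by simp only; omega)
    · have heq : g l = g l' + m l' l := le_antisymm (hg l l') (not_lt.1 hlt)
      have hy' : y ⟨l', x⟩ ∈ L.Ppow (g l' + 1) := by
        by_cases hl'S : l' ∈ S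
        · exact ih l' ⟨hne, heq⟩ hl'S x
        · exact (hS l hl l' hl'S).resolve_right hlt x
      exact L.Pmul_le hy' (hC _ _) (by simp only; omega)
  intro x
  have h1 := hNS l hl (fun x => L.ϖ ^ (-g l) * y ⟨l, x⟩)
    (fun x => L.Pmul_le (L.pi_mem le_rfl) (hy _) (by simp)) (fun b => by
      have : ∑ a, L.ϖ ^ (-g l) * y ⟨l, a⟩ * blk l C a b =
          L.ϖ ^ (-g l) * ∑ a, y ⟨l, a⟩ * C ⟨l, a⟩ ⟨l, b⟩ := by
        rw [Finset.mul_sum]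
        exact Finset.sum_congr rfl fun a _ => by rw [mul_assoc]; rfl
      rw [this]
      exact L.Pmul_le (L.pi_mem le_rfl) (key b) (by omega)) x
  have h2 : L.ϖ ^ (-g l) * y ⟨l, x⟩ ∈ L.Ppow (-g l + (g l + 1)) := by
    rw [show -g l + (g l + 1) = 1 by ring]; exact h1
  exact L.P_pi_mul.1 h2

lemma inv_mem_of_NS (h0 : ∀ i, m i i = 0) (htri : ∀ i j k, m i k ≤ m i j + m j k)
    (hpos : ∀ i j, i ≠ j → 0 < m i j + m j i) {A B : Matrix (BlockIdx nv) (BlockIdx nv) L.D}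
    (hB : ∀ a b, B a b ∈ L.Ppow (m a.1 b.1)) (hAB : A * B = 1) (hNS : ∀ l, NS L (blk l B)) :
    ∀ a b, A a b ∈ L.Ppow (m a.1 b.1) := by
  intro k
  have step : ∀ n : ℕ, (∀ c, A k c ∈ L.Ppow (m k.1 c.1 - n)) → ∀ c, A k c ∈ L.Ppow (m k.1 c.1) := by
    intro n
    induction n with
    | zero => intro h c; simpa using h c
    | succ n ih =>
      intro h
      apply ih
      intro c
      have := propagate htri hpos hB (A k) (fun l => m k.1 l - (n + 1 : ℕ)) h
        (fun l l' => by have := htri k.1 l' l; omega) Set.univ (fun l _ => hNS l)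
        (fun l _ x => by
          have e : ∑ c, A k c * B c ⟨l, x⟩ = (1 : Matrix (BlockIdx nv) (BlockIdx nv) L.D) k ⟨l, x⟩ := by
            rw [← hAB, Matrix.mul_apply]
          rw [e, Matrix.one_apply]
          split_ifs with hk
          · subst hk
            exact L.Ppow_one_mem (by rw [h0]; push_cast; omega)
          · exact L.Ppow_zero_mem _)
        (fun l _ l' hl' => absurd (Set.mem_univ l') hl') c.1 (Set.mem_univ _) c.2
      refine L.Ppow_mono ?_ this
      push_cast
      omega
  obtain ⟨K, hK⟩ := L.exists_P (A k)
  refine step (K + ∑ l, (m k.1 l).natAbs) fun c => L.Ppow_mono ?_ (hK c)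
  have := Finset.single_le_sum (f := fun l => (m k.1 l).natAbs) (fun i _ => Nat.zero_le _)
    (Finset.mem_univ c.1)
  omega

lemma cross_mem (h0 : ∀ i, m i i = 0) (htri : ∀ i j k, m i k ≤ m i j + m j k)
    (hpos : ∀ i j, i ≠ j → 0 < m i j + m j i) {B C : Matrix (BlockIdx nv) (BlockIdx nv) L.D}
    (hB : ∀ a b, B a b ∈ L.Ppow (m a.1 b.1)) (hC : ∀ a b, C a b ∈ L.Ppow (m a.1 b.1))
    (p q : BlockIdx nv)
    (hz : ∀ l, l ≠ p.1 → l ≠ q.1 → ∀ z, (B * C) p ⟨l, z⟩ = 0)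
    (hNS : ∀ l, l ≠ p.1 → l ≠ q.1 → NS L (blk l C))
    (hrow : ∀ x, B p ⟨p.1, x⟩ ∈ L.Ppow 1) (hcol : ∀ x, C ⟨q.1, x⟩ q ∈ L.Ppow 1) :
    (B * C) p q ∈ L.Ppow (m p.1 q.1 + 1) := by
  have hprop := propagate htri hpos hC (B p) (fun l => m p.1 l) (hB p)
    (fun l l' => htri p.1 l' l) {l | l ≠ p.1 ∧ l ≠ q.1 ∧ m p.1 l + m l q.1 = m p.1 q.1}
    (fun l hl => hNS l hl.1 hl.2.1)
    (fun l hl x => by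
      have := hz l hl.1 hl.2.1 x
      rw [Matrix.mul_apply] at this
      rw [this]
      exact L.Ppow_zero_mem _)
    (fun l hl l' hl' => by
      obtain ⟨hl1, hl2, hl3⟩ := hl
      by_cases hp : l' = p.1
      · subst hp
        left
        intro x
        rw [h0]
        exact hrow x
      by_cases hq : l' = q.1
      · subst hq
        right
        have := hpos l _ hl2
        omega
      right
      have k1 : m p.1 l' + m l' q.1 ≠ m p.1 q.1 := fun h => hl' ⟨hp, hq, h⟩
      have k2 := htri p.1 l' q.1
      have k3 := htri l' l q.1
      omega)
  rw [Matrix.mul_apply]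
  refine L.Psum_mem _ _ fun c _ => ?_
  obtain ⟨l, x⟩ := c
  by_cases hp : l = p.1
  · subst hp
    exact L.Pmul_le (hrow x) (hC _ _) (by simp only; omega)
  by_cases hq : l = q.1
  · subst hq
    exact L.Pmul_le (hB _ _) (hcol x) (by simp only; omega)
  by_cases he : m p.1 l + m l q.1 = m p.1 q.1
  · exact L.Pmul_le (hprop l ⟨hp, hq, he⟩ x) (hC _ _) (by simp only; omega)
  · have := htri p.1 l q.1
    exact L.Pmul_le (hB _ _) (hC _ _) (by simp only; omega)

lemma corner_facts (h0 : ∀ i, m i i = 0)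
    (hpos : ∀ i j, i ≠ j → 0 < m i j + m j i) {B C : Matrix (BlockIdx nv) (BlockIdx nv) L.D}
    (hB : ∀ a b, B a b ∈ L.Ppow (m a.1 b.1)) (hC : ∀ a b, C a b ∈ L.Ppow (m a.1 b.1))
    (p : BlockIdx nv)
    (h : EntP L 1 (blk p.1 (B * C) - (1 - Matrix.single p.2 p.2 1))) :
    ¬ (NS L (blk p.1 B) ∧ NS L (blk p.1 C)) ∧
    (¬ NS L (blk p.1 B) → ∀ x, B p ⟨p.1, x⟩ ∈ L.Ppow 1) ∧
    (¬ NS L (blk p.1 C) → ∀ x, C ⟨p.1, x⟩ p ∈ L.Ppow 1) := by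
  have h' : EntP L 1 (blk p.1 B * blk p.1 C - (1 - Matrix.single p.2 p.2 1)) := by
    have := h.sub (blk_mul hpos hB hC p.1)
    have e : blk p.1 (B * C) - (1 - Matrix.single p.2 p.2 1) -
        (blk p.1 (B * C) - blk p.1 B * blk p.1 C) =
        blk p.1 B * blk p.1 C - (1 - Matrix.single p.2 p.2 1) := by abel
    rwa [e] at this
  have iB := blk_int h0 hB p.1
  have iC := blk_int h0 hC p.1
  refine ⟨fun hh => not_both_NS iB p.2 h' hh.1 hh.2, fun hn x => ?_, fun hn x => ?_⟩
  · exact row_of_not_NS iC p.2 iB h' hn x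
  · by_contra hx
    exact hn (NS_of_col iB iC p.2 h' (a := x) hx)

lemma atom_criterion (h0 : ∀ i, m i i = 0) (htri : ∀ i j k, m i k ≤ m i j + m j k)
    (hpos : ∀ i j, i ≠ j → 0 < m i j + m j i) {p q : BlockIdx nv} (hpq : p.1 ≠ q.1)
    (α : L.matDot (L.stdOrder m (Sigma.fst : BlockIdx nv → Fin r) h0 htri))
    (hone : ∀ a b, ¬ ((a = p ∨ a = q) ∧ (b = p ∨ b = q)) → α.1 a b = (1 : Matrix (BlockIdx nv) (BlockIdx nv) L.D) a b)
    (hpp : α.1 p p ∈ L.Ppow 1) (hqq : α.1 q q ∈ L.Ppow 1)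
    (hpq' : α.1 p q ∉ L.Ppow (m p.1 q.1 + 1)) (hqp' : α.1 q p ∉ L.Ppow (m q.1 p.1 + 1)) :
    IsAtomM α := by
  have corner : ∀ s : BlockIdx nv, (s = p ∨ s = q) →
      EntP L 1 (blk s.1 α.1 - (1 - Matrix.single s.2 s.2 1)) := by
    intro s hs x y
    have hss : α.1 s s ∈ L.Ppow 1 := by
      rcases hs with rfl | rfl
      · exact hpp
      · exact hqq
    by_cases hxy : x = s.2 ∧ y = s.2
    · obtain ⟨rfl, rfl⟩ := hxy
      simpa [blk] using hss
    · have hu : ∀ t : BlockIdx nv, t.1 = s.1 → (t = p ∨ t = q) → t = s := by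
        intro t ht h
        rcases hs with rfl | rfl <;> rcases h with rfl | rfl
        · rfl
        · exact absurd ht.symm hpq
        · exact absurd ht hpq
        · rfl
      have e1 : α.1 ⟨s.1, x⟩ ⟨s.1, y⟩ = (1 : Matrix (BlockIdx nv) (BlockIdx nv) L.D) ⟨s.1, x⟩ ⟨s.1, y⟩ := by
        refine hone _ _ fun h => hxy ?_
        have k1 := hu ⟨s.1, x⟩ rfl h.1
        have k2 := hu ⟨s.1, y⟩ rfl h.2
        exact ⟨eq_of_heq (Sigma.ext_iff.1 k1).2, eq_of_heq (Sigma.ext_iff.1 k2).2⟩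
      have e2 : (blk s.1 α.1 - (1 - Matrix.single s.2 s.2 1) : Matrix _ _ L.D) x y = 0 := by
        rw [Matrix.sub_apply, Matrix.sub_apply]
        unfold blk
        rw [e1, Matrix.single_apply, if_neg (fun h => hxy ⟨h.1.symm, h.2.symm⟩), sub_zero,
          Matrix.one_apply, Matrix.one_apply]
        simp
      rw [e2]
      exact L.Ppow_zero_mem _
  have hαO : ∀ a b, α.1 a b ∈ L.Ppow (m a.1 b.1) := α.2.1
  constructor
  · intro hu
    rw [unit_iff] at hu
    obtain ⟨γ, hγ, h1, -⟩ := hu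
    have hγ' : ∀ a b, γ a b ∈ L.Ppow (m a.1 b.1) := hγ
    have hrow : ∀ x, α.1 p ⟨p.1, x⟩ ∈ L.Ppow 1 := by
      intro x
      by_cases hx : (⟨p.1, x⟩ : BlockIdx nv) = p
      · rw [hx]; exact hpp
      · rw [hone, Matrix.one_apply_ne (Ne.symm hx)]
        · exact L.Ppow_zero_mem _
        · rintro ⟨-, h | h⟩
          · exact hx h
          · have h' : p.1 = q.1 := (Sigma.ext_iff.1 h).1
            exact hpq h'
    have k1 := blk_mul hpos hαO hγ' p.1 p.2 p.2
    rw [h1, Matrix.sub_apply, Matrix.mul_apply] at k1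
    have k2 : ∑ j, blk p.1 α.1 p.2 j * blk p.1 γ j p.2 ∈ L.Ppow 1 :=
      L.Psum_mem _ _ fun j _ => L.Pmul_le (hrow j) (blk_int h0 hγ' p.1 j p.2) (by omega)
    have k3 := L.Ppow_add_mem k1 k2
    rw [sub_add_cancel] at k3
    have k4 : blk p.1 (1 : Matrix (BlockIdx nv) (BlockIdx nv) L.D) p.2 p.2 = 1 := by simp [blk]
    rw [k4] at k3
    exact L.one_notMem k3
  · intro b c hbc
    have hB : ∀ x y, b.1 x y ∈ L.Ppow (m x.1 y.1) := b.2.1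
    have hC : ∀ x y, c.1 x y ∈ L.Ppow (m x.1 y.1) := c.2.1
    have hα : α.1 = b.1 * c.1 := congrArg Subtype.val hbc
    have other : ∀ l, l ≠ p.1 → l ≠ q.1 → EntP L 1 (blk l b.1 * blk l c.1 - 1) := by
      intro l hp hq
      have e1 : blk l α.1 = 1 := by
        ext x y
        have : α.1 ⟨l, x⟩ ⟨l, y⟩ = (1 : Matrix (BlockIdx nv) (BlockIdx nv) L.D) ⟨l, x⟩ ⟨l, y⟩ := by
          refine hone _ _ ?_
          rintro ⟨h | h, -⟩
          · exact hp (congrArg Sigma.fst h)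
          · exact hq (congrArg Sigma.fst h)
        change α.1 ⟨l, x⟩ ⟨l, y⟩ = _
        rw [this, Matrix.one_apply, Matrix.one_apply]
        simp
      have e2 := blk_mul hpos hB hC l
      rw [← hα, e1] at e2
      intro x y
      have := L.Ppow_neg_mem (e2 x y)
      rwa [← Matrix.neg_apply, neg_sub] at this
    have oB : ∀ l, l ≠ p.1 → l ≠ q.1 → NS L (blk l b.1) := fun l hp hq =>
      NS_left_of_mul (blk_int h0 hC l) (other l hp hq)
    have oC : ∀ l, l ≠ p.1 → l ≠ q.1 → NS L (blk l c.1) := fun l hp hq =>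
      NS_of_mul (blk_int h0 hB l) (other l hp hq)
    have cp := corner p (Or.inl rfl)
    have cq := corner q (Or.inr rfl)
    rw [hα] at cp cq
    obtain ⟨p1, p2, p3⟩ := corner_facts h0 hpos hB hC p cp
    obtain ⟨q1, q2, q3⟩ := corner_facts h0 hpos hB hC q cq
    have zero : ∀ s, (s = p ∨ s = q) → ∀ l, l ≠ p.1 → l ≠ q.1 → ∀ z, (b.1 * c.1) s ⟨l, z⟩ = 0 := by
      intro s hs l hp hq z
      rw [← hα, hone, Matrix.one_apply_ne]
      · rintro h
        rcases hs with rfl | rfl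
        · exact hp (congrArg Sigma.fst h).symm
        · exact hq (congrArg Sigma.fst h).symm
      · rintro ⟨-, h | h⟩
        · exact hp (congrArg Sigma.fst h)
        · exact hq (congrArg Sigma.fst h)
    have x1 : ¬ NS L (blk p.1 b.1) → NS L (blk q.1 c.1) := by
      intro hb
      by_contra hc
      refine hpq' ?_
      rw [hα]
      exact cross_mem h0 htri hpos hB hC p q (zero p (Or.inl rfl)) oC (p2 hb) (q3 hc)
    have x2 : ¬ NS L (blk q.1 b.1) → NS L (blk p.1 c.1) := by
      intro hb
      by_contra hc
      refine hqp' ?_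
      rw [hα]
      exact cross_mem h0 htri hpos hB hC q p (fun l h1 h2 => zero q (Or.inr rfl) l h2 h1)
        (fun l h1 h2 => oC l h2 h1) (q2 hb) (p3 hc)
    have fin : ∀ d : L.matDot (L.stdOrder m (Sigma.fst : BlockIdx nv → Fin r) h0 htri),
        (∀ l, NS L (blk l d.1)) → IsUnit d := by
      intro d hd
      rw [unit_iff]
      obtain ⟨A, h1, h2⟩ := L.exists_inv d.2.2
      exact ⟨A, inv_mem_of_NS h0 htri hpos d.2.1 h2 hd, h1, h2⟩
    by_cases hbp : NS L (blk p.1 b.1)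
    · have hbq : NS L (blk q.1 b.1) := by
        by_contra h
        exact p1 ⟨hbp, x2 h⟩
      left
      apply fin
      intro l
      by_cases hp : l = p.1
      · subst hp; exact hbp
      by_cases hq : l = q.1
      · subst hq; exact hbq
      exact oB l hp hq
    · have hcq := x1 hbp
      have hcp : NS L (blk p.1 c.1) := x2 fun h => q1 ⟨h, hcq⟩
      right
      apply fin
      intro l
      by_cases hp : l = p.1
      · subst hp; exact hcp
      by_cases hq : l = q.1
      · subst hq; exact hcq
      exact oC l hp hq

end AtomsNonHereditary

section Emb

variable {L : LocalCSA} {ι : Type} [Fintype ι] [DecidableEq ι]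

/-- a `2 × 2` matrix placed at the indices `p`, `q` -/
def emb (p q : ι) (x y z t : L.D) : Matrix ι ι L.D := fun a b =>
  if a = p then (if b = p then x else if b = q then y else 0)
  else if a = q then (if b = p then z else if b = q then t else 0)
  else if a = b then 1 else 0

lemma emb_one {p q : ι} (hpq : p ≠ q) : emb (L := L) p q 1 0 0 1 = 1 := by
  ext a b
  unfold emb
  rw [Matrix.one_apply]
  split_ifs <;> simp_all

lemma emb_mul {p q : ι} (hpq : p ≠ q) (x y z t x' y' z' t' : L.D) :
    emb p q x y z t * emb p q x' y' z' t' =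
      emb p q (x * x' + y * z') (x * y' + y * t') (z * x' + t * z') (z * y' + t * t') := by
  ext a b
  rw [Matrix.mul_apply]
  have h2 : ∀ (u v : L.D) (f : ι → L.D), ∑ c, (if c = p then u else if c = q then v else 0) * f c =
      u * f p + v * f q := by
    intro u v f
    have : ∀ c, (if c = p then u else if c = q then v else 0) * f c =
        (if c = p then u * f p else 0) + (if c = q then v * f q else 0) := by
      intro c
      by_cases h : c = p
      · subst h; simp [hpq]
      · by_cases h' : c = q
        · subst h'; simp [h]
        · simp [h, h']
    simp [this, Finset.sum_add_distrib]
  by_cases ha : a = p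
  · subst ha
    have : ∀ c, emb a q x y z t a c = if c = a then x else if c = q then y else 0 := fun c => by
      simp [emb]
    simp only [this]
    rw [h2]
    simp only [emb, if_true, if_neg hpq.symm]
    split_ifs <;> simp
  · by_cases ha' : a = q
    · subst ha'
      have : ∀ c, emb p a x y z t a c = if c = p then z else if c = a then t else 0 := fun c => by
        simp [emb, ha]
      simp only [this]
      rw [h2]
      simp only [emb, if_true, if_neg hpq.symm]
      split_ifs <;> simp
    · have : ∀ c, emb p q x y z t a c = if a = c then 1 else 0 := fun c => by
        simp [emb, ha, ha']
      simp only [this, ite_mul, one_mul, zero_mul, Finset.sum_ite_eq, Finset.mem_univ, if_true]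
      simp [emb, ha, ha']

lemma emb_pow {p q : ι} (hpq : p ≠ q) (x : L.D) (k : ℕ) :
    emb p q x 0 0 x ^ k = emb p q (x ^ k) 0 0 (x ^ k) := by
  induction k with
  | zero => simp [emb_one hpq]
  | succ k ih => rw [pow_succ, ih, emb_mul hpq, pow_succ]; simp

end Emb

end LocalCSA

end Paper

namespace Paper

namespace LocalCSA

section Family

variable {L : LocalCSA} {r : ℕ} {nv : Fin r → ℕ} {m : Fin r → Fin r → ℤ}

lemma emb_mem (h0 : ∀ i, m i i = 0) {p q : BlockIdx nv} {x y z t : L.D}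
    (hx : x ∈ L.Ppow 0) (hy : y ∈ L.Ppow (m p.1 q.1)) (hz : z ∈ L.Ppow (m q.1 p.1))
    (ht : t ∈ L.Ppow 0) (a b : BlockIdx nv) : emb p q x y z t a b ∈ L.Ppow (m a.1 b.1) := by
  unfold emb
  by_cases ha : a = p
  · subst ha
    rw [if_pos rfl]
    split_ifs with h1 h2
    · subst h1; rw [h0]; exact hx
    · subst h2; exact hy
    · exact L.Ppow_zero_mem _
  rw [if_neg ha]
  by_cases ha' : a = q
  · subst ha'
    rw [if_pos rfl]
    split_ifs with h1 h2
    · subst h1; exact hz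
    · subst h2; rw [h0]; exact ht
    · exact L.Ppow_zero_mem _
  rw [if_neg ha']
  split_ifs with h
  · subst h; rw [h0]; exact L.Ppow_one_mem le_rfl
  · exact L.Ppow_zero_mem _

lemma emb_atom (h0 : ∀ i, m i i = 0) (htri : ∀ i j k, m i k ≤ m i j + m j k)
    (hpos : ∀ i j, i ≠ j → 0 < m i j + m j i) {p q : BlockIdx nv} (hpq : p.1 ≠ q.1)
    {x y z t : L.D} (hx : x ∈ L.Ppow 1) (hy : y ∈ L.Ppow (m p.1 q.1))
    (hz : z ∈ L.Ppow (m q.1 p.1)) (ht : t ∈ L.Ppow 1)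
    (hy' : y ∉ L.Ppow (m p.1 q.1 + 1)) (hz' : z ∉ L.Ppow (m q.1 p.1 + 1))
    (hn : L.nrd (emb p q x y z t) ≠ 0) :
    ∃ A : L.matDot (L.stdOrder m (Sigma.fst : BlockIdx nv → Fin r) h0 htri),
      A.1 = emb p q x y z t ∧ IsAtomM A := by
  have hne : p ≠ q := fun h => hpq (by rw [h])
  refine ⟨⟨emb p q x y z t, emb_mem h0 (L.Ppow_mono (by omega) hx) hy hz
    (L.Ppow_mono (by omega) ht), hn⟩, rfl, ?_⟩
  refine atom_criterion h0 htri hpos hpq _ ?_ ?_ ?_ ?_ ?_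
  · intro a b hab
    change emb p q x y z t a b = _
    unfold emb
    rw [Matrix.one_apply]
    by_cases ha : a = p
    · subst ha
      have h1 : b ≠ a := fun h => hab ⟨Or.inl rfl, Or.inl h⟩
      have h2 : b ≠ q := fun h => hab ⟨Or.inl rfl, Or.inr h⟩
      simp [h1, h2, h1.symm]
    · by_cases ha' : a = q
      · subst ha'
        have h1 : b ≠ p := fun h => hab ⟨Or.inr rfl, Or.inl h⟩
        have h2 : b ≠ a := fun h => hab ⟨Or.inr rfl, Or.inr h⟩
        simp [h1, h2, h2.symm]
      · simp [ha, ha']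
  · simpa [emb] using hx
  · simpa [emb, hne.symm] using ht
  · simpa [emb, hne.symm] using hy'
  · simpa [emb, hne.symm] using hz'

lemma exists_pair (h0 : ∀ i, m i i = 0) (htri : ∀ i j k, m i k ≤ m i j + m j k)
    (hpos : ∀ i j, i ≠ j → 0 < m i j + m j i) {p q : BlockIdx nv} (hpq : p.1 ≠ q.1)
    (s : ℤ) (hs : m p.1 q.1 + m q.1 p.1 = s) (hs2 : 2 ≤ s) (N : ℤ) (hN : 1 ≤ N) :
    ∃ A A' : L.matDot (L.stdOrder m (Sigma.fst : BlockIdx nv → Fin r) h0 htri),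
      IsAtomM A ∧ IsAtomM A' ∧
      A.1 * A'.1 = emb p q (L.ϖ ^ (N + s)) 0 0 (L.ϖ ^ (N + s)) ∧
      A'.1 * A.1 = emb p q (L.ϖ ^ (N + s)) 0 0 (L.ϖ ^ (N + s)) := by
  have hne : p ≠ q := fun h => hpq (by rw [h])
  have hz : ∀ a b : ℤ, L.ϖ ^ a * L.ϖ ^ b = L.ϖ ^ (a + b) := fun a b => (zpow_add₀ L.ϖ_ne a b).symm
  set u := m p.1 q.1 with hu
  set v := m q.1 p.1 with hv
  have e1 : emb p q (L.ϖ ^ (1 : ℤ) + L.ϖ ^ (N + 1)) (L.ϖ ^ u) (L.ϖ ^ v) (L.ϖ ^ (s - 1)) *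
      emb p q (L.ϖ ^ (s - 1)) (-L.ϖ ^ u) (-L.ϖ ^ v) (L.ϖ ^ (1 : ℤ) + L.ϖ ^ (N + 1)) =
      emb p q (L.ϖ ^ (N + s)) 0 0 (L.ϖ ^ (N + s)) := by
    rw [emb_mul hne]
    congr 1
    · simp only [add_mul, mul_add, mul_neg, hz]
      rw [hs, show 1 + (s - 1) = s by ring, show N + 1 + (s - 1) = N + s by ring]
      abel
    · simp only [add_mul, mul_add, mul_neg, hz]
      rw [add_comm u 1, add_comm u (N + 1)]
      abel
    · simp only [add_mul, mul_add, mul_neg, hz]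
      rw [add_comm v]
      abel
    · simp only [add_mul, mul_add, mul_neg, hz]
      rw [add_comm v u, hs, show s - 1 + 1 = s by ring, show s - 1 + (N + 1) = N + s by ring]
      abel
  have e2 : emb p q (L.ϖ ^ (s - 1)) (-L.ϖ ^ u) (-L.ϖ ^ v) (L.ϖ ^ (1 : ℤ) + L.ϖ ^ (N + 1)) *
      emb p q (L.ϖ ^ (1 : ℤ) + L.ϖ ^ (N + 1)) (L.ϖ ^ u) (L.ϖ ^ v) (L.ϖ ^ (s - 1)) =
      emb p q (L.ϖ ^ (N + s)) 0 0 (L.ϖ ^ (N + s)) := by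
    rw [emb_mul hne]
    congr 1
    · simp only [add_mul, mul_add, neg_mul, hz]
      rw [hs, show s - 1 + 1 = s by ring, show s - 1 + (N + 1) = N + s by ring]
      abel
    · simp only [add_mul, mul_add, neg_mul, hz]
      rw [add_comm u]
      abel
    · simp only [add_mul, mul_add, neg_mul, hz]
      rw [add_comm v 1, add_comm v (N + 1)]
      abel
    · simp only [add_mul, mul_add, neg_mul, hz]
      rw [add_comm v u, hs, show 1 + (s - 1) = s by ring, show N + 1 + (s - 1) = N + s by ring]
      abel
  have e3 : emb p q (L.ϖ ^ (N + s)) 0 0 (L.ϖ ^ (N + s)) *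
      emb p q (L.ϖ ^ (-(N + s))) 0 0 (L.ϖ ^ (-(N + s))) = 1 := by
    rw [emb_mul hne, hz]
    simp [emb_one hne]
  have hx : L.ϖ ^ (1 : ℤ) + L.ϖ ^ (N + 1) ∈ L.Ppow 1 :=
    L.Ppow_add_mem (L.pi_mem le_rfl) (L.pi_mem (by omega))
  have ht : L.ϖ ^ (s - 1) ∈ L.Ppow 1 := L.pi_mem (by omega)
  have hnot : ∀ e : ℤ, L.ϖ ^ e ∉ L.Ppow (e + 1) := fun e h => by
    rw [L.mem_P_iff (L.pi_ne e), L.w_pi] at h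
    omega
  have hnot' : ∀ e : ℤ, -L.ϖ ^ e ∉ L.Ppow (e + 1) := fun e h => by
    have := L.Ppow_neg_mem h
    rw [neg_neg] at this
    exact hnot e this
  obtain ⟨A, hA, hA'⟩ := emb_atom h0 htri hpos hpq hx (L.pi_mem le_rfl) (L.pi_mem le_rfl) ht
    (hnot u) (hnot v) (L.nrd_ne_of_mul (by rw [← e1, mul_assoc] at e3; exact e3))
  obtain ⟨B, hB, hB'⟩ := emb_atom h0 htri hpos hpq ht (L.Ppow_neg_mem (L.pi_mem le_rfl))
    (L.Ppow_neg_mem (L.pi_mem le_rfl)) hx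
    (hnot' u) (hnot' v) (L.nrd_ne_of_mul (by rw [← e2, mul_assoc] at e3; exact e3))
  exact ⟨A, B, hA', hB', by rw [hA, hB, e1], by rw [hA, hB, e2]⟩

lemma exists_family (h0 : ∀ i, m i i = 0) (htri : ∀ i j k, m i k ≤ m i j + m j k)
    (hpos : ∀ i j, i ≠ j → 0 < m i j + m j i) (hnv : ∀ i, 0 < nv i)
    (hne : ¬ ∀ i j, i ≠ j → m i j + m j i = 1) :
    ∃ a a' : ℕ → L.matDot (L.stdOrder m (Sigma.fst : BlockIdx nv → Fin r) h0 htri),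
        (∀ k : ℕ, 1 ≤ k → IsAtomM (a k) ∧ IsAtomM (a' k)) ∧
        (∀ k : ℕ, 1 ≤ k → a k * a' k = (a 1) ^ k * (a' 1) ^ k) := by
  push Not at hne
  obtain ⟨i, j, hij, hs⟩ := hne
  have hp := hpos i j hij
  let p : BlockIdx nv := ⟨i, ⟨0, hnv i⟩⟩
  let q : BlockIdx nv := ⟨j, ⟨0, hnv j⟩⟩
  have hpq : p ≠ q := fun h => hij (congrArg Sigma.fst h)
  set s := m i j + m j i with hsd
  have key : ∀ k : ℕ, ∃ A A' : L.matDot (L.stdOrder m (Sigma.fst : BlockIdx nv → Fin r) h0 htri),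
      IsAtomM A ∧ IsAtomM A' ∧
      A.1 * A'.1 = emb p q ((L.ϖ ^ (s + 1)) ^ (max k 1)) 0 0 ((L.ϖ ^ (s + 1)) ^ (max k 1)) ∧
      A'.1 * A.1 = emb p q ((L.ϖ ^ (s + 1)) ^ (max k 1)) 0 0 ((L.ϖ ^ (s + 1)) ^ (max k 1)) := by
    intro k
    have hk : (1 : ℤ) ≤ ((max k 1 : ℕ) : ℤ) := by exact_mod_cast le_max_right k 1
    have := exists_pair (L := L) h0 htri hpos (p := p) (q := q) hij s hsd.symm (by omega)
      ((s + 1) * ((max k 1 : ℕ) : ℤ) - s) (by nlinarith)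
    rw [sub_add_cancel, zpow_mul, zpow_natCast] at this
    exact this
  choose a a' h1 h2 h3 h4 using key
  refine ⟨a, a', fun k _ => ⟨h1 k, h2 k⟩, fun k hk => ?_⟩
  have hc : Commute (a 1) (a' 1) := Subtype.ext (by
    change (a 1).1 * (a' 1).1 = (a' 1).1 * (a 1).1
    rw [h3, h4])
  rw [← hc.mul_pow]
  apply Subtype.ext
  change (a k).1 * (a' k).1 = ((a 1).1 * (a' 1).1) ^ k
  rw [h3, h3, emb_pow hpq, max_eq_left hk, max_self, pow_one]

end Family

end LocalCSA

end Paper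

namespace Paper

namespace LocalCSA

section Lam

variable (L : LocalCSA) {ι : Type} [Fintype ι] [DecidableEq ι]

lemma v_one : L.v 1 = 0 := by
  have h := L.v_mul 1 1 one_ne_zero one_ne_zero
  rw [one_mul] at h
  omega

lemma v_pow {x : L.Kp} (hx : x ≠ 0) (n : ℕ) : L.v (x ^ n) = n * L.v x := by
  induction n with
  | zero => simp [L.v_one]
  | succ n ih =>
    rw [pow_succ, L.v_mul _ _ (pow_ne_zero _ hx) hx, ih]
    push_cast
    ring

/-- valuation of the reduced norm -/
noncomputable def lam (A : Matrix ι ι L.D) : ℤ := L.v (L.nrd A)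

lemma lam_mul {A B : Matrix ι ι L.D} (hA : L.nrd A ≠ 0) (hB : L.nrd B ≠ 0) :
    L.lam (A * B) = L.lam A + L.lam B := by
  unfold lam
  rw [L.nrd_mul, L.v_mul _ _ hA hB]

lemma lam_one : L.lam (1 : Matrix ι ι L.D) = 0 := by
  unfold lam
  rw [L.nrd_one, L.v_one]

lemma nrd_ne_of_mul' {A B : Matrix ι ι L.D} (h : A * B = 1) : L.nrd B ≠ 0 :=
  L.nrd_ne_of_mul (mul_eq_one_comm.1 h)

lemma nrd_mul_ne {A B : Matrix ι ι L.D} (hA : L.nrd A ≠ 0) (hB : L.nrd B ≠ 0) :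
    L.nrd (A * B) ≠ 0 := by
  rw [L.nrd_mul]; exact mul_ne_zero hA hB

lemma lam_nonneg {E : ι → ι → ℤ} (htri : ∀ a b c, E a c ≤ E a b + E b c)
    {A : Matrix ι ι L.D} (hA : ∀ a b, A a b ∈ L.Ppow (E a b)) (hn : L.nrd A ≠ 0) :
    0 ≤ L.lam A := by
  rcases isEmpty_or_nonempty ι with hι | ⟨⟨q⟩⟩
  · have : A = 1 := by ext a; exact isEmptyElim a
    rw [this, L.lam_one]
  have h1 : Matrix.diagonal (fun a => L.ϖ ^ (E q a)) * Matrix.diagonal (fun a => L.ϖ ^ (-E q a)) =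
      (1 : Matrix ι ι L.D) := by
    rw [Matrix.diagonal_mul_diagonal, ← Matrix.diagonal_one]
    congr 1
    funext a
    rw [← zpow_add₀ L.ϖ_ne, add_neg_cancel, zpow_zero]
  have h2 := L.nrd_int (Matrix.diagonal (fun a => L.ϖ ^ (E q a)) * A *
    Matrix.diagonal (fun a => L.ϖ ^ (-E q a))) (fun a b => by
      rw [Matrix.mul_diagonal, Matrix.diagonal_mul]
      have := htri q a b
      exact L.Pmul_le (L.Pmul_le (L.pi_mem le_rfl) (hA a b) le_rfl) (L.pi_mem le_rfl)
        (show (0 : ℤ) ≤ _ by omega))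
  have h3 := congrArg L.nrd h1
  rw [L.nrd_mul, L.nrd_one] at h3
  have h4 : L.nrd (Matrix.diagonal (fun a => L.ϖ ^ (E q a)) * A *
    Matrix.diagonal (fun a => L.ϖ ^ (-E q a))) = L.nrd A := by
    rw [L.nrd_mul, L.nrd_mul, mul_right_comm, h3, one_mul]
  rw [h4] at h2
  exact h2.resolve_left hn

lemma lam_unit {E : ι → ι → ℤ} (htri : ∀ a b c, E a c ≤ E a b + E b c)
    {A B : Matrix ι ι L.D} (hA : ∀ a b, A a b ∈ L.Ppow (E a b))
    (hB : ∀ a b, B a b ∈ L.Ppow (E a b)) (hAB : A * B = 1) : L.lam A = 0 := by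
  have nA := L.nrd_ne_of_mul hAB
  have nB := L.nrd_ne_of_mul' hAB
  have h1 := L.lam_nonneg htri hA nA
  have h2 := L.lam_nonneg htri hB nB
  have h3 := L.lam_mul nA nB
  rw [hAB, L.lam_one] at h3
  omega

lemma lam_unit' {A B : Matrix ι ι L.D} (hA : ∀ a b, A a b ∈ L.Ppow 0)
    (hB : ∀ a b, B a b ∈ L.Ppow 0) (hAB : A * B = 1) : L.lam A = 0 :=
  L.lam_unit (E := fun _ _ => 0) (fun _ _ _ => by simp) hA hB hAB

/-- diagonal matrix with a single nontrivial entry -/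
def dg (a : ι) (x : L.D) : Matrix ι ι L.D := Matrix.diagonal (Function.update 1 a x)

lemma dg_one (a : ι) : L.dg a 1 = 1 := by
  unfold dg
  rw [← Matrix.diagonal_one]
  congr 1
  funext b
  rw [Function.update_apply]
  split_ifs <;> simp

lemma dg_mul (a : ι) (x y : L.D) : L.dg a x * L.dg a y = L.dg a (x * y) := by
  unfold dg
  rw [Matrix.diagonal_mul_diagonal]
  congr 1
  funext b
  simp only [Function.update_apply]
  split_ifs <;> simp

lemma dg_nrd (a : ι) {x : L.D} (hx : x ≠ 0) : L.nrd (L.dg a x) ≠ 0 :=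
  L.nrd_ne_of_mul (B := L.dg a x⁻¹) (by rw [dg_mul, mul_inv_cancel₀ hx, dg_one])

lemma dg_int (a : ι) {x : L.D} (hx : x ∈ L.Ppow 0) (b c : ι) : L.dg a x b c ∈ L.Ppow 0 := by
  unfold dg
  rw [Matrix.diagonal_apply, Function.update_apply]
  split_ifs
  · exact hx
  · exact L.Ppow_one_mem le_rfl
  · exact L.Ppow_zero_mem _

lemma lam_dg_unit (a : ι) {x : L.D} (hx : x ≠ 0) (hw : L.w x = 0) : L.lam (L.dg a x) = 0 :=
  L.lam_unit' (B := L.dg a x⁻¹) (L.dg_int a (Or.inr hw.ge))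
    (L.dg_int a (Or.inr (by rw [L.w_inv hx]; omega)))
    (by rw [dg_mul, mul_inv_cancel₀ hx, dg_one])

lemma lam_dg_pow (a : ι) (n : ℕ) : L.lam (L.dg a (L.ϖ ^ n)) = n * L.lam (L.dg a L.ϖ) := by
  induction n with
  | zero => simp [dg_one, lam_one]
  | succ n ih =>
    rw [pow_succ, ← dg_mul, L.lam_mul (L.dg_nrd a (pow_ne_zero _ L.ϖ_ne)) (L.dg_nrd a L.ϖ_ne), ih]
    push_cast
    ring

lemma lam_dg (a : ι) {x : L.D} (hx : x ≠ 0) : L.lam (L.dg a x) = L.w x * L.lam (L.dg a L.ϖ) := by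
  have key : ∀ (n : ℕ) (y : L.D), y ≠ 0 → L.w y = n →
      L.lam (L.dg a y) = n * L.lam (L.dg a L.ϖ) := by
    intro n y hy hw
    have hu : y * (L.ϖ ^ n)⁻¹ ≠ 0 := mul_ne_zero hy (inv_ne_zero (pow_ne_zero _ L.ϖ_ne))
    have e : y = y * (L.ϖ ^ n)⁻¹ * L.ϖ ^ n := by
      rw [mul_assoc, inv_mul_cancel₀ (pow_ne_zero _ L.ϖ_ne), mul_one]
    have hwu : L.w (y * (L.ϖ ^ n)⁻¹) = 0 := by
      rw [L.w_mul _ _ hy (inv_ne_zero (pow_ne_zero _ L.ϖ_ne)),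
        L.w_inv (pow_ne_zero _ L.ϖ_ne), L.w_pow L.ϖ_ne, L.w_ϖ, hw]
      ring
    rw [e, ← dg_mul, L.lam_mul (L.dg_nrd a hu) (L.dg_nrd a (pow_ne_zero _ L.ϖ_ne)),
      L.lam_dg_unit a hu hwu, L.lam_dg_pow, zero_add]
  obtain ⟨n, hn | hn⟩ := (L.w x).eq_nat_or_neg
  · rw [key n x hx hn, hn]
  · have h1 := key n x⁻¹ (inv_ne_zero hx) (by rw [L.w_inv hx]; omega)
    have h2 := L.lam_mul (L.dg_nrd a hx) (L.dg_nrd a (inv_ne_zero hx))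
    rw [dg_mul, mul_inv_cancel₀ hx, dg_one, lam_one] at h2
    rw [hn]
    linarith

/-- monomial matrix -/
def mono (t : ι → L.D) (σ : Equiv.Perm ι) : Matrix ι ι L.D := fun a b => if σ a = b then t a else 0

lemma mono_mul (t s : ι → L.D) (σ τ : Equiv.Perm ι) :
    L.mono t σ * L.mono s τ = L.mono (fun a => t a * s (σ a)) (τ * σ) := by
  ext a b
  rw [Matrix.mul_apply]
  rw [Finset.sum_eq_single (σ a)]
  · by_cases h : τ (σ a) = b <;> simp [mono, h]
  · intro c _ hc
    simp [mono, hc.symm]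
  · intro h
    exact absurd (Finset.mem_univ _) h

lemma mono_one : L.mono (fun _ : ι => 1) 1 = 1 := by
  ext a b
  rw [Matrix.one_apply]
  by_cases h : a = b <;> simp [mono, h]

lemma mono_inv {t : ι → L.D} (ht : ∀ a, t a ≠ 0) (σ : Equiv.Perm ι) :
    L.mono t σ * L.mono (fun b => (t (σ⁻¹ b))⁻¹) σ⁻¹ = 1 := by
  rw [mono_mul, ← mono_one]
  simp [ht]

lemma mono_diag (t : ι → L.D) : L.mono t 1 = Matrix.diagonal t := by
  ext a b
  rw [Matrix.diagonal_apply]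
  by_cases h : a = b <;> simp [mono, h]

lemma dg_mono (a : ι) (x : L.D) (t : ι → L.D) (σ : Equiv.Perm ι) :
    L.dg a x * L.mono t σ = L.mono (Function.update t a (x * t a)) σ := by
  unfold dg
  rw [← mono_diag, mono_mul, mul_one]
  congr 1
  funext b
  by_cases h : b = a
  · subst h; simp
  · simp [h]

lemma mono_nrd {t : ι → L.D} (ht : ∀ a, t a ≠ 0) (σ : Equiv.Perm ι) : L.nrd (L.mono t σ) ≠ 0 :=
  L.nrd_ne_of_mul (L.mono_inv ht σ)

lemma lam_perm (σ : Equiv.Perm ι) : L.lam (L.mono (fun _ => 1) σ) = 0 := by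
  have hi : ∀ (τ : Equiv.Perm ι) a b, L.mono (fun _ => 1) τ a b ∈ L.Ppow 0 := by
    intro τ a b
    unfold mono
    split_ifs
    · exact L.Ppow_one_mem le_rfl
    · exact L.Ppow_zero_mem _
  have := L.mono_inv (t := fun _ : ι => (1 : L.D)) (fun _ => one_ne_zero) σ
  simp only [inv_one] at this
  exact L.lam_unit' (hi σ) (hi σ⁻¹) this

lemma lam_dg_eq (a b : ι) : L.lam (L.dg a L.ϖ) = L.lam (L.dg b L.ϖ) := by
  have h : L.mono (fun _ => 1) (Equiv.swap a b) * L.dg b L.ϖ =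
      L.dg a L.ϖ * L.mono (fun _ => 1) (Equiv.swap a b) := by
    rw [dg_mono]
    unfold dg
    rw [← mono_diag, mono_mul, one_mul]
    congr 1
    funext c
    simp only [Function.update_apply, one_mul, mul_one]
    by_cases hc : c = a
    · subst hc; simp
    · have : Equiv.swap a b c ≠ b := fun h => hc
        ((Equiv.swap a b).injective (h.trans (Equiv.swap_apply_left a b).symm))
      simp [hc, this]
  have h1 := congrArg L.lam h
  have np := L.mono_nrd (t := fun _ : ι => (1 : L.D)) (fun _ => one_ne_zero) (Equiv.swap a b)
  rw [L.lam_mul np (L.dg_nrd b L.ϖ_ne), L.lam_mul (L.dg_nrd a L.ϖ_ne) np, lam_perm] at h1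
  omega

lemma lam_diag (q : ι) {t : ι → L.D} (ht : ∀ a, t a ≠ 0) :
    L.lam (Matrix.diagonal t) = (∑ a, L.w (t a)) * L.lam (L.dg q L.ϖ) := by
  have key : ∀ s : Finset ι, L.nrd (Matrix.diagonal fun a => if a ∈ s then t a else 1) ≠ 0 ∧
      L.lam (Matrix.diagonal fun a => if a ∈ s then t a else 1) =
      (∑ a ∈ s, L.w (t a)) * L.lam (L.dg q L.ϖ) := by
    intro s
    induction s using Finset.induction_on with
    | empty => simp [lam_one, L.nrd_one]
    | insert a s ha ih =>
      have e : (Matrix.diagonal fun b => if b ∈ insert a s then t b else 1) =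
          L.dg a (t a) * Matrix.diagonal fun b => if b ∈ s then t b else 1 := by
        unfold dg
        rw [Matrix.diagonal_mul_diagonal]
        congr 1
        funext b
        by_cases hb : b = a
        · subst hb; simp [ha]
        · simp [hb]
      rw [e]
      refine ⟨L.nrd_mul_ne (L.dg_nrd a (ht a)) ih.1, ?_⟩
      rw [L.lam_mul (L.dg_nrd a (ht a)) ih.1, ih.2, Finset.sum_insert ha, L.lam_dg a (ht a),
        L.lam_dg_eq a q]
      ring
  simpa using (key Finset.univ).2

lemma lam_mono (q : ι) {t : ι → L.D} (ht : ∀ a, t a ≠ 0) (σ : Equiv.Perm ι) :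
    L.lam (L.mono t σ) = (∑ a, L.w (t a)) * L.lam (L.dg q L.ϖ) := by
  have e : L.mono t σ = Matrix.diagonal t * L.mono (fun _ => 1) σ := by
    rw [← mono_diag, mono_mul]
    simp
  have nd : L.nrd (Matrix.diagonal t) ≠ 0 := by rw [← mono_diag]; exact L.mono_nrd ht 1
  rw [e, L.lam_mul nd (L.mono_nrd (fun _ => one_ne_zero) σ), lam_perm, add_zero, L.lam_diag q ht]

lemma lam_dg_pos (q : ι) : 0 < L.lam (L.dg q L.ϖ) := by
  have hne : algebraMap L.Kp L.D L.piK ≠ 0 := by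
    rw [Ne, FaithfulSMul.algebraMap_eq_zero_iff]; exact L.piK_ne
  have h1 := L.lam_diag q (t := fun _ => algebraMap L.Kp L.D L.piK) (fun _ => hne)
  simp only [L.w_algebraMap _ L.piK_ne, L.v_piK, Finset.sum_const, Finset.card_univ, mul_one,
    nsmul_eq_mul] at h1
  have hd : Matrix.diagonal (fun _ : ι => algebraMap L.Kp L.D L.piK) =
      L.piK • (1 : Matrix ι ι L.D) := by
    rw [← Algebra.algebraMap_eq_smul_one]
    rfl
  rw [hd] at h1
  obtain ⟨f, -, -, hf, hfn⟩ := L.nrd_charpoly (L.piK • (1 : Matrix ι ι L.D))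
  set N := Fintype.card ι * L.d with hN
  have hml : LinearMap.mulLeft L.Kp (L.piK • (1 : Matrix ι ι L.D)) =
      L.piK • (LinearMap.id : Matrix ι ι L.D →ₗ[L.Kp] Matrix ι ι L.D) := by
    ext1 x
    simp
  have hdet := LinearMap.det_eq_sign_charpoly_coeff
    (LinearMap.mulLeft L.Kp (L.piK • (1 : Matrix ι ι L.D)))
  rw [← hf, Polynomial.coeff_zero_eq_eval_zero, Polynomial.eval_pow,
    ← Polynomial.coeff_zero_eq_eval_zero, hml, LinearMap.det_smul, LinearMap.det_id, mul_one] at hdet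
  set n := Module.finrank L.Kp (Matrix ι ι L.D) with hn
  have hnpos : 0 < n := by
    have : Nonempty ι := ⟨q⟩
    exact Module.finrank_pos
  have hvs : ∀ k : ℕ, L.v ((-1) ^ k) = 0 := fun k => by
    rw [L.v_pow (by simp), L.v_neg, L.v_one, mul_zero]
  have hsne : ∀ k : ℕ, ((-1 : L.Kp)) ^ k ≠ 0 := fun k => pow_ne_zero _ (by simp)
  have hc0 : f.coeff 0 ^ N ≠ 0 := by
    intro h
    rw [h, mul_zero] at hdet
    exact pow_ne_zero _ L.piK_ne hdet
  have hNne : N ≠ 0 := by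
    intro h
    have h0 : L.d = 0 := by
      rcases Nat.mul_eq_zero.1 (hN.symm.trans h) with h | h
      · exact absurd (Fintype.card_eq_zero_iff.1 h) (fun hh => hh.false q)
      · exact h
    have := L.degD
    rw [h0] at this
    have h2 : 0 < Module.finrank L.Kp L.D := Module.finrank_pos
    omega
  have hcc : f.coeff 0 ≠ 0 := fun h => hc0 (by rw [h, zero_pow hNne])
  have hv := congrArg L.v hdet
  rw [L.v_pow L.piK_ne, L.v_mul _ _ (hsne _) hc0, hvs, L.v_pow hcc, L.v_piK] at hv
  have hl : L.lam (L.piK • (1 : Matrix ι ι L.D)) = L.v (f.coeff 0) := by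
    unfold lam
    rw [hfn, L.v_mul _ _ (hsne _) hcc, hvs, zero_add]
  rw [← hl, h1] at hv
  have hNN : (Fintype.card ι : ℤ) * (L.d : ℤ) = (N : ℤ) := by rw [hN]; push_cast; rfl
  rw [hNN] at hv
  by_contra hcon
  have k1 : (0 : ℤ) < n := by exact_mod_cast hnpos
  have k2 : (0 : ℤ) ≤ (N : ℤ) * N := by positivity
  nlinarith

end Lam

end LocalCSA

end Paper

namespace Paper

namespace LocalCSA

section Bruhat

variable (L : LocalCSA) {ι : Type} [Fintype ι] [DecidableEq ι]

/-- units of the order with exponent matrix `E` -/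
def EUnit (E : ι → ι → ℤ) (U : Matrix ι ι L.D) : Prop :=
  (∀ a b, U a b ∈ L.Ppow (E a b)) ∧ ∃ U' : Matrix ι ι L.D, U * U' = 1 ∧ U' * U = 1 ∧
    ∀ a b, U' a b ∈ L.Ppow (E a b)

variable {L} {E : ι → ι → ℤ}

lemma inE_mul (htri : ∀ a b c, E a c ≤ E a b + E b c) {A B : Matrix ι ι L.D}
    (hA : ∀ a b, A a b ∈ L.Ppow (E a b)) (hB : ∀ a b, B a b ∈ L.Ppow (E a b)) (a b : ι) :
    (A * B) a b ∈ L.Ppow (E a b) := by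
  rw [Matrix.mul_apply]
  exact L.Psum_mem _ _ fun c _ => L.Pmul_le (hA a c) (hB c b) (htri a c b)

lemma inE_one (h0 : ∀ a, E a a = 0) (a b : ι) :
    (1 : Matrix ι ι L.D) a b ∈ L.Ppow (E a b) := by
  rw [Matrix.one_apply]
  split_ifs with h
  · subst h; exact L.Ppow_one_mem (h0 a).le
  · exact L.Ppow_zero_mem _

lemma EUnit.mul (htri : ∀ a b c, E a c ≤ E a b + E b c) {A B : Matrix ι ι L.D}
    (hA : EUnit L E A) (hB : EUnit L E B) : EUnit L E (A * B) := by
  obtain ⟨h1, A', h2, h3, h4⟩ := hA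
  obtain ⟨k1, B', k2, k3, k4⟩ := hB
  refine ⟨inE_mul htri h1 k1, B' * A', ?_, ?_, inE_mul htri k4 h4⟩
  · rw [mul_assoc, ← mul_assoc B, k2, one_mul, h2]
  · rw [mul_assoc, ← mul_assoc A', h3, one_mul, k3]

lemma EUnit.one (h0 : ∀ a, E a a = 0) : EUnit L E 1 :=
  ⟨inE_one h0, 1, one_mul 1, one_mul 1, inE_one h0⟩

lemma EUnit.nrd {A : Matrix ι ι L.D} (hA : EUnit L E A) : L.nrd A ≠ 0 := by
  obtain ⟨-, A', h2, -, -⟩ := hA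
  exact L.nrd_ne_of_mul h2

lemma EUnit.lam (htri : ∀ a b c, E a c ≤ E a b + E b c) {A : Matrix ι ι L.D}
    (hA : EUnit L E A) : L.lam A = 0 := by
  obtain ⟨h1, A', h2, -, h4⟩ := hA
  exact L.lam_unit htri h1 h4 h2

lemma EUnit.of_sq (h0 : ∀ a, E a a = 0) {X : Matrix ι ι L.D}
    (hX : ∀ a b, X a b ∈ L.Ppow (E a b)) (hsq : X * X = 0) : EUnit L E (1 - X) := by
  refine ⟨fun a b => L.Psub_mem (inE_one h0 a b) (hX a b), 1 + X, ?_, ?_,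
    fun a b => L.Ppow_add_mem (inE_one h0 a b) (hX a b)⟩
  · rw [sub_mul, one_mul, mul_add, hsq, mul_one]; abel
  · rw [mul_sub, mul_one, add_mul, hsq, one_mul]; abel

/-- row `p` is clean: it has one nonzero entry, the only one in its column -/
def Clean (A : Matrix ι ι L.D) (p : ι) : Prop :=
  ∃ q, A p q ≠ 0 ∧ (∀ j, j ≠ q → A p j = 0) ∧ (∀ i, i ≠ p → A i q = 0)

lemma elim_step (h0 : ∀ a, E a a = 0) {A : Matrix ι ι L.D} {p q : ι} (hpq : A p q ≠ 0)
    (hcol : ∀ i, i ≠ p → A i q * (A p q)⁻¹ ∈ L.Ppow (E i p))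
    (hrow : ∀ j, j ≠ q → (A p q)⁻¹ * A p j ∈ L.Ppow (E q j)) :
    ∃ U V : Matrix ι ι L.D, EUnit L E U ∧ EUnit L E V ∧ ∀ i j, (U * A * V) i j =
      if i = p then (if j = q then A p q else 0) else A i j - A i q * (A p q)⁻¹ * A p j := by
  let x : ι → L.D := fun i => if i = p then 0 else A i q * (A p q)⁻¹
  let y : ι → L.D := fun j => if j = q then 0 else (A p q)⁻¹ * A p j
  let X : Matrix ι ι L.D := fun i j => if j = p then x i else 0
  let Y : Matrix ι ι L.D := fun i j => if i = q then y j else 0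
  have hXm : ∀ (B : Matrix ι ι L.D) i j, (X * B) i j = x i * B p j := by
    intro B i j
    rw [Matrix.mul_apply]
    simp [X]
  have hYm : ∀ (B : Matrix ι ι L.D) i j, (B * Y) i j = B i q * y j := by
    intro B i j
    rw [Matrix.mul_apply]
    simp [Y]
  have hX2 : X * X = 0 := by
    ext i j
    rw [hXm]
    simp [X, x]
  have hY2 : Y * Y = 0 := by
    ext i j
    rw [hYm]
    simp [Y, y]
  refine ⟨1 - X, 1 - Y, EUnit.of_sq h0 ?_ hX2, EUnit.of_sq h0 ?_ hY2, ?_⟩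
  · intro i j
    simp only [X, x]
    split_ifs with h1 h2
    · exact L.Ppow_zero_mem _
    · subst h1; exact hcol i h2
    · exact L.Ppow_zero_mem _
  · intro i j
    simp only [Y, y]
    split_ifs with h1 h2
    · exact L.Ppow_zero_mem _
    · subst h1; exact hrow j h2
    · exact L.Ppow_zero_mem _
  · intro i j
    rw [mul_sub, mul_one, Matrix.sub_apply, hYm, sub_mul, one_mul, Matrix.sub_apply,
      Matrix.sub_apply, hXm, hXm]
    simp only [x, y]
    by_cases hi : i = p
    · subst hi
      by_cases hj : j = q
      · subst hj; simp
      · simp [hj, mul_inv_cancel_left₀ hpq]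
    · simp [hi, mul_assoc, inv_mul_cancel₀ hpq]

lemma exists_pivot (h0 : ∀ a, E a a = 0) (htri : ∀ a b c, E a c ≤ E a b + E b c)
    (h1 : ∀ a b, E a b + E b a ≤ 1) (A : Matrix ι ι L.D) (T : ι → Prop)
    (hT : ∃ i j, T i ∧ A i j ≠ 0) :
    ∃ p q, T p ∧ A p q ≠ 0 ∧ (∀ i, T i → A i q ≠ 0 → L.w (A p q) + E i p ≤ L.w (A i q)) ∧
      (∀ j, A p j ≠ 0 → L.w (A p q) + E q j ≤ L.w (A p j)) := by
  classical
  let S : Finset (ι × ι) := Finset.univ.filter fun x => T x.1 ∧ A x.1 x.2 ≠ 0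
  let ht : ι × ι → ℤ := fun x => Fintype.card ι * L.w (A x.1 x.2) + ∑ d, (E d x.1 + E x.2 d)
  obtain ⟨i0, j0, hi0, hij0⟩ := hT
  obtain ⟨⟨p, q⟩, hpq, hmin⟩ := S.exists_min_image ht ⟨(i0, j0), by simp [S, hi0, hij0]⟩
  simp only [S, Finset.mem_filter, Finset.mem_univ, true_and] at hpq hmin
  have hcard : (0 : ℤ) < Fintype.card ι := by
    exact_mod_cast Fintype.card_pos_iff.2 ⟨p⟩
  have arith : ∀ (x y e : ℤ) (f g : ι → ℤ) (k : ι), Fintype.card ι * x + ∑ d, f d ≤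
      Fintype.card ι * y + ∑ d, g d → (∀ d, e - 1 ≤ f d - g d) → e ≤ f k - g k → x + e ≤ y := by
    intro x y e f g k hle hall hk
    have s1 := Finset.single_le_sum (f := fun d => f d - g d - (e - 1))
      (fun d _ => by have := hall d; omega) (Finset.mem_univ k)
    rw [Finset.sum_sub_distrib, Finset.sum_sub_distrib, Finset.sum_const, Finset.card_univ,
      nsmul_eq_mul] at s1
    by_contra hcon
    have : y - x ≤ e - 1 := by omega
    nlinarith
  refine ⟨p, q, hpq.1, hpq.2, fun i hi hiq => ?_, fun j hpj => ?_⟩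
  · have := hmin (i, q) ⟨hi, hiq⟩
    simp only [ht] at this
    refine arith _ _ _ _ _ i this (fun d => ?_) ?_
    · have k1 := htri d p i
      have k2 := h1 i p
      omega
    · rw [h0]; omega
  · have := hmin (p, j) ⟨hpq.1, hpj⟩
    simp only [ht] at this
    refine arith _ _ _ _ _ j this (fun d => ?_) ?_
    · have k1 := htri j q d
      have k2 := h1 j q
      omega
    · rw [h0]; omega

lemma bruhat (h0 : ∀ a, E a a = 0) (htri : ∀ a b c, E a c ≤ E a b + E b c)
    (h1 : ∀ a b, E a b + E b a ≤ 1) : ∀ (n : ℕ) (A : Matrix ι ι L.D), L.nrd A ≠ 0 →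
    Set.ncard {p | ¬ Clean A p} ≤ n →
    ∃ U V : Matrix ι ι L.D, EUnit L E U ∧ EUnit L E V ∧ ∀ p, Clean (U * A * V) p := by
  intro n
  induction n with
  | zero =>
    intro A _ hc
    refine ⟨1, 1, EUnit.one h0, EUnit.one h0, fun p => ?_⟩
    rw [one_mul, mul_one]
    by_contra hp
    have := (Set.ncard_eq_zero (Set.toFinite _)).1 (Nat.le_zero.1 hc)
    exact (Set.ext_iff.1 this p).1 hp
  | succ n ih =>
    intro A hA hc
    by_cases hall : ∀ p, Clean A p
    · refine ⟨1, 1, EUnit.one h0, EUnit.one h0, fun p => ?_⟩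
      rw [one_mul, mul_one]
      exact hall p
    push Not at hall
    obtain ⟨i0, hi0⟩ := hall
    have hnz : ∃ i j, ¬ Clean A i ∧ A i j ≠ 0 := by
      by_contra hcon
      push Not at hcon
      obtain ⟨B, hB, -⟩ := L.exists_inv hA
      have := congrFun (congrFun hB i0) i0
      rw [Matrix.mul_apply, Matrix.one_apply_eq] at this
      simp [hcon i0 _ hi0] at this
    obtain ⟨p, q, hp, hpq, hcol, hrow⟩ := exists_pivot h0 htri h1 A (fun i => ¬ Clean A i) hnz
    have hw : L.w (A p q)⁻¹ = -L.w (A p q) := L.w_inv hpq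
    obtain ⟨U, V, hU, hV, hUV⟩ := elim_step (E := E) h0 hpq (fun i hi => by
        by_cases hz : A i q = 0
        · rw [hz, zero_mul]; exact L.Ppow_zero_mem _
        · have hni : ¬ Clean A i := by
            rintro ⟨q', k1, k2, k3⟩
            have : q = q' := by
              by_contra hne
              exact hz (k2 q hne)
            subst this
            exact hpq (k3 p (Ne.symm hi))
          have := hcol i hni hz
          exact L.Pmul_le (L.mem_P_w _) (L.mem_P_w _) (by rw [hw]; omega))
      (fun j hj => by
        by_cases hz : A p j = 0
        · rw [hz, mul_zero]; exact L.Ppow_zero_mem _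
        · have := hrow j hz
          exact L.Pmul_le (L.mem_P_w _) (L.mem_P_w _) (by rw [hw]; omega))
    have hsub : {i | ¬ Clean (U * A * V) i} ⊂ {i | ¬ Clean A i} := by
      refine ⟨fun i hi => ?_, fun hcon => ?_⟩
      · by_contra hcl
        simp only [Set.mem_ofPred_eq, not_not] at hcl
        obtain ⟨q', k1, k2, k3⟩ := hcl
        apply hi
        have hip : i ≠ p := by
          rintro rfl
          exact hp ⟨q', k1, k2, k3⟩
        have hpq' : A p q' = 0 := k3 p hip.symm
        have hqq : q ≠ q' := by
          rintro rfl
          exact hpq hpq'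
        have hiq : A i q = 0 := k2 q hqq
        refine ⟨q', ?_, ?_, ?_⟩
        · rw [hUV, if_neg hip, hiq]; simpa using k1
        · intro j hj
          rw [hUV, if_neg hip, hiq, k2 j hj]; simp
        · intro k hk
          rw [hUV]
          split_ifs with hkp hq
          · exact absurd hq.symm hqq
          · rfl
          · rw [hpq', k3 k hk]; simp
      · refine hcon hp ⟨q, ?_, ?_, ?_⟩
        · rw [hUV, if_pos rfl, if_pos rfl]; exact hpq
        · intro j hj
          rw [hUV, if_pos rfl, if_neg hj]
        · intro i hi
          rw [hUV, if_neg hi, mul_assoc, inv_mul_cancel₀ hpq, mul_one, sub_self]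
    have hlt := Set.ncard_lt_ncard hsub (Set.toFinite _)
    obtain ⟨U', V', hU', hV', hcl⟩ := ih (U * A * V)
      (L.nrd_mul_ne (L.nrd_mul_ne hU.nrd hA) hV.nrd) (by omega)
    refine ⟨U' * U, V * V', hU'.mul htri hU, hV.mul htri hV', ?_⟩
    have e : U' * U * A * (V * V') = U' * (U * A * V) * V' := by simp only [mul_assoc]
    rw [e]
    exact hcl

lemma mono_of_clean {A : Matrix ι ι L.D} (h : ∀ p, Clean A p) :
    ∃ (t : ι → L.D) (σ : Equiv.Perm ι), (∀ a, t a ≠ 0) ∧ A = L.mono t σ := by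
  choose f h1 h2 h3 using h
  have hinj : Function.Injective f := by
    intro a b hab
    by_contra hne
    have := h3 b a hne
    rw [← hab] at this
    exact h1 a this
  refine ⟨fun a => A a (f a), Equiv.ofBijective f (Finite.injective_iff_bijective.1 hinj), h1, ?_⟩
  ext a b
  simp only [mono, Equiv.ofBijective_apply]
  split_ifs with h
  · rw [h]
  · exact h2 a b (Ne.symm h)

lemma decomp (h0 : ∀ a, E a a = 0) (htri : ∀ a b c, E a c ≤ E a b + E b c)
    (h1 : ∀ a b, E a b + E b a ≤ 1) {A : Matrix ι ι L.D} (hA : L.nrd A ≠ 0)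
    (hAE : ∀ a b, A a b ∈ L.Ppow (E a b)) :
    ∃ (U V : Matrix ι ι L.D) (t : ι → L.D) (σ : Equiv.Perm ι), EUnit L E U ∧ EUnit L E V ∧
      (∀ a, t a ≠ 0) ∧ A = U * L.mono t σ * V ∧ ∀ a, E a (σ a) ≤ L.w (t a) := by
  obtain ⟨U, V, ⟨u1, U', u2, u3, u4⟩, ⟨v1, V', v2, v3, v4⟩, hcl⟩ := bruhat h0 htri h1 _ A hA le_rfl
  obtain ⟨t, σ, ht, hm⟩ := mono_of_clean hcl
  refine ⟨U', V', t, σ, ⟨u4, U, u3, u2, u1⟩, ⟨v4, V, v3, v2, v1⟩, ht, ?_, fun a => ?_⟩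
  · rw [← hm]
    have e : U' * (U * A * V) * V' = (U' * U) * A * (V * V') := by simp only [mul_assoc]
    rw [e, u3, v2, one_mul, mul_one]
  · have := inE_mul htri (inE_mul htri u1 hAE) v1 a (σ a)
    rw [hm] at this
    simp only [mono, if_true] at this
    exact (L.mem_P_iff (ht a)).1 this

end Bruhat

end LocalCSA

end Paper

namespace Paper

namespace LocalCSA

section FiniteElasticity

variable {L : LocalCSA} {ι : Type} [Fintype ι] [DecidableEq ι] {E : ι → ι → ℤ}

lemma eunit_of_lam (h0 : ∀ a, E a a = 0) (htri : ∀ a b c, E a c ≤ E a b + E b c)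
    (h1 : ∀ a b, E a b + E b a ≤ 1) (q : ι) {A : Matrix ι ι L.D} (hA : L.nrd A ≠ 0)
    (hAE : ∀ a b, A a b ∈ L.Ppow (E a b)) (hl : L.lam A = 0) : EUnit L E A := by
  obtain ⟨U, V, t, σ, hU, hV, ht, rfl, hw⟩ := decomp h0 htri h1 hA hAE
  have hm := L.mono_nrd ht σ
  rw [L.lam_mul (L.nrd_mul_ne hU.nrd hm) hV.nrd, L.lam_mul hU.nrd hm, hU.lam htri, hV.lam htri,
    L.lam_mono q ht, zero_add, add_zero] at hl
  have hsum : ∑ a, L.w (t a) = 0 :=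
    (mul_eq_zero.1 hl).resolve_right (L.lam_dg_pos q).ne'
  have hval : ∀ k a, L.w (t a) = E a k - E (σ a) k := by
    intro k
    have hs : ∑ a, (L.w (t a) - (E a k - E (σ a) k)) = 0 := by
      rw [Finset.sum_sub_distrib, Finset.sum_sub_distrib, hsum,
        Equiv.sum_comp σ (fun a => E a k)]
      ring
    have := (Finset.sum_eq_zero_iff_of_nonneg (fun a _ => by
      have k1 := htri a (σ a) k
      have k2 := hw a
      omega)).1 hs
    intro a
    have := this a (Finset.mem_univ a)
    omega
  refine (hU.mul htri ⟨?_, _, L.mono_inv ht σ, mul_eq_one_comm.1 (L.mono_inv ht σ), ?_⟩).mul htri hV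
  · intro a b
    unfold mono
    split_ifs with h
    · subst h; exact Or.inr (hw a)
    · exact L.Ppow_zero_mem _
  · intro a b
    unfold mono
    split_ifs with h
    · subst h
      refine Or.inr ?_
      rw [L.w_inv (ht _), hval (σ⁻¹ a) (σ⁻¹ a), h0]
      simp
    · exact L.Ppow_zero_mem _

lemma finite_elasticity (h0 : ∀ a, E a a = 0) (htri : ∀ a b c, E a c ≤ E a b + E b c)
    (h1 : ∀ a b, E a b + E b a ≤ 1) (O : Subring (Matrix ι ι L.D))
    (hO : ∀ B, B ∈ O ↔ ∀ a b, B a b ∈ L.Ppow (E a b)) : elasticity (L.matDot O) < ⊤ := by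
  rcases isEmpty_or_nonempty ι with hι | ⟨⟨q⟩⟩
  · have hsub : ∀ a b : L.matDot O, a = b := fun a b =>
      Subtype.ext (by ext x; exact isEmptyElim x)
    exact elasticity_lt_top (fun _ => 0) (fun _ _ => rfl) (fun _ _ => rfl)
      (fun a ha => absurd (by rw [hsub a 1]; exact isUnit_one) ha) 0 (fun _ _ => le_rfl)
  set c := L.lam (L.dg q L.ϖ) with hc
  have hcpos : 0 < c := L.lam_dg_pos q
  have hnn : ∀ a : L.matDot O, 0 ≤ L.lam a.1 := fun a =>
    L.lam_nonneg htri ((hO _).1 a.2.1) a.2.2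
  have hmul : ∀ a b : L.matDot O, L.lam (a * b).1 = L.lam a.1 + L.lam b.1 := fun a b =>
    L.lam_mul a.2.2 b.2.2
  have hunit : ∀ a : L.matDot O, IsUnit a ↔ L.lam a.1 = 0 := by
    intro a
    rw [unit_iff]
    constructor
    · rintro ⟨B, hB, k1, -⟩
      exact L.lam_unit htri ((hO _).1 a.2.1) ((hO _).1 hB) k1
    · intro hl
      obtain ⟨-, B, k1, k2, k3⟩ := eunit_of_lam h0 htri h1 q a.2.2 ((hO _).1 a.2.1) hl
      exact ⟨B, (hO _).2 k3, k1, k2⟩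
  let K : ℕ := ∑ x : ι × ι, (E x.1 x.2).natAbs
  have hK : ∀ a b, E a b ≤ K := by
    intro a b
    have := Finset.single_le_sum (f := fun x : ι × ι => (E x.1 x.2).natAbs)
      (fun i _ => Nat.zero_le _) (Finset.mem_univ (a, b))
    simp only at this
    have h2 : (E a b).natAbs ≤ K := this
    omega
  have hatom : ∀ a : L.matDot O, IsAtomM a → L.lam a.1 ≤ (Fintype.card ι * K + 1) * c := by
    intro a ha
    by_contra hcon
    push Not at hcon
    obtain ⟨U, V, t, σ, hU, hV, ht, hdec, hw⟩ := decomp h0 htri h1 a.2.2 ((hO _).1 a.2.1)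
    have hm := L.mono_nrd ht σ
    have hla : L.lam a.1 = (∑ b, L.w (t b)) * c := by
      rw [hdec, L.lam_mul (L.nrd_mul_ne hU.nrd hm) hV.nrd, L.lam_mul hU.nrd hm, hU.lam htri,
        hV.lam htri, L.lam_mono q ht, zero_add, add_zero]
    have hbig : (Fintype.card ι * K + 1 : ℤ) < ∑ b, L.w (t b) := by
      rw [hla] at hcon
      exact lt_of_mul_lt_mul_right hcon hcpos.le
    obtain ⟨s, hs⟩ : ∃ s, (K : ℤ) < L.w (t s) := by
      by_contra hno
      push Not at hno
      have := Finset.sum_le_card_nsmul Finset.univ (fun b => L.w (t b)) K (fun b _ => hno b)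
      rw [Finset.card_univ, nsmul_eq_mul] at this
      omega
    let t' : ι → L.D := Function.update t s (L.ϖ⁻¹ * t s)
    have ht' : ∀ b, t' b ≠ 0 := by
      intro b
      simp only [t', Function.update_apply]
      split_ifs
      · exact mul_ne_zero (inv_ne_zero L.ϖ_ne) (ht s)
      · exact ht b
    have hw' : ∀ b, E b (σ b) ≤ L.w (t' b) := by
      intro b
      simp only [t', Function.update_apply]
      split_ifs with hb
      · subst hb
        rw [L.w_mul _ _ (inv_ne_zero L.ϖ_ne) (ht b), L.w_inv L.ϖ_ne, L.w_ϖ]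
        have := hK b (σ b)
        omega
      · exact hw b
    have hmm : L.mono t σ = L.dg s L.ϖ * L.mono t' σ := by
      rw [dg_mono]
      congr 1
      funext b
      by_cases hb : b = s
      · subst hb; simp [t', mul_inv_cancel_left₀ L.ϖ_ne]
      · simp [t', hb]
    have hdO : ∀ x y, L.dg s L.ϖ x y ∈ L.Ppow (E x y) := by
      intro x y
      by_cases hxy : x = y
      · subst hxy
        rw [h0]
        exact L.dg_int s (Or.inr (by rw [L.w_ϖ]; omega)) x x
      · unfold dg
        rw [Matrix.diagonal_apply_ne _ hxy]
        exact L.Ppow_zero_mem _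
    have hmO : ∀ x y, L.mono t' σ x y ∈ L.Ppow (E x y) := by
      intro x y
      unfold mono
      split_ifs with h
      · subst h; exact Or.inr (hw' x)
      · exact L.Ppow_zero_mem _
    have nd := L.dg_nrd s L.ϖ_ne
    have nm := L.mono_nrd ht' σ
    let b1 : L.matDot O := ⟨U * L.dg s L.ϖ, (hO _).2 (inE_mul htri hU.1 hdO),
      L.nrd_mul_ne hU.nrd nd⟩
    let b2 : L.matDot O := ⟨L.mono t' σ * V, (hO _).2 (inE_mul htri hmO hV.1),
      L.nrd_mul_ne nm hV.nrd⟩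
    have hab : a = b1 * b2 := by
      apply Subtype.ext
      change a.1 = (U * L.dg s L.ϖ) * (L.mono t' σ * V)
      rw [hdec, hmm]
      simp only [mul_assoc]
    have l1 : L.lam b1.1 = c := by
      change L.lam (U * L.dg s L.ϖ) = c
      rw [L.lam_mul hU.nrd nd, hU.lam htri, zero_add, hc, L.lam_dg_eq s q]
    have l2 : L.lam a.1 = L.lam b1.1 + L.lam b2.1 := by rw [← hmul, ← hab]
    have hKn : (0 : ℤ) ≤ Fintype.card ι * K := by positivity
    rcases ha.2 b1 b2 hab with h | h
    · rw [hunit, l1] at h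
      omega
    · rw [hunit] at h
      rw [h, l1, hla] at l2
      nlinarith
  refine elasticity_lt_top (fun a => (L.lam a.1).toNat) (fun a b => ?_) (fun a ha => ?_)
    (fun a ha => ?_) ((Fintype.card ι * K + 1) * c).toNat (fun a ha => ?_)
  · have := hmul a b
    have k1 := hnn a
    have k2 := hnn b
    omega
  · rw [(hunit a).1 ha]
    rfl
  · rw [hunit] at ha
    have := hnn a
    omega
  · exact Int.toNat_le_toNat (hatom a ha)

end FiniteElasticity

end LocalCSA

end Paper

open Paper Paper.LocalCSA in
/-- Let `O = O(ñ, M) ⊆ M_n(D_p)` be a tiled order in standard form.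
TFAE: (1) `ρ(O^•) < ∞`; (2) `m_ij + m_ji = 1` for all `i ≠ j`; (3) `O` is hereditary.
Moreover if these fail there exist atoms `{α_k, α'_k}` with `α_k α'_k = α_1^k (α'_1)^k`;
in particular `ρ_k(O^•) = ∞` for all `k ≥ 2`, `2·ℤ_{≥1} ⊆ U_{2k}(O^•)` and
`1 + 2·ℤ_{≥1} ⊆ U_{2k+1}(O^•)` for all `k ≥ 1`. -/
theorem standard_form_elasticity_equivalence (L : LocalCSA) (r : ℕ) (nv : Fin r → ℕ)
    (hnv : ∀ i, 0 < nv i) (m : Fin r → Fin r → ℤ) (hstd : IsStdForm m) :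
    (((elasticity ↥(L.matDot (L.stdOrder m (Sigma.fst : BlockIdx nv → Fin r)
          hstd.1 hstd.2.1)) < ⊤) ↔
        (∀ i j : Fin r, i ≠ j → m i j + m j i = 1)) ∧
      ((∀ i j : Fin r, i ≠ j → m i j + m j i = 1) ↔
        IsHereditaryRing
          ↥(L.stdOrder m (Sigma.fst : BlockIdx nv → Fin r) hstd.1 hstd.2.1))) ∧
    (¬ (∀ i j : Fin r, i ≠ j → m i j + m j i = 1) →
      (∃ a a' : ℕ → ↥(L.matDot (L.stdOrder m (Sigma.fst : BlockIdx nv → Fin r)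
          hstd.1 hstd.2.1)),
        (∀ k : ℕ, 1 ≤ k → IsAtomM (a k) ∧ IsAtomM (a' k)) ∧
        (∀ k : ℕ, 1 ≤ k → a k * a' k = (a 1) ^ k * (a' 1) ^ k)) ∧
      (∀ k : ℕ, 2 ≤ k →
        refinedElasticity ↥(L.matDot (L.stdOrder m (Sigma.fst : BlockIdx nv → Fin r)
          hstd.1 hstd.2.1)) k = ⊤) ∧
      (∀ k : ℕ, 1 ≤ k →
        (∀ j : ℕ, 1 ≤ j → 2 * j ∈
          lengthUnion ↥(L.matDot (L.stdOrder m (Sigma.fst : BlockIdx nv → Fin r)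
            hstd.1 hstd.2.1)) (2 * k)) ∧
        (∀ j : ℕ, 1 ≤ j → 1 + 2 * j ∈
          lengthUnion ↥(L.matDot (L.stdOrder m (Sigma.fst : BlockIdx nv → Fin r)
            hstd.1 hstd.2.1)) (2 * k + 1)))) := by
  have h0 := hstd.1
  have htri := hstd.2.1
  have hpos := hstd.2.2
  have hfam := fun hne => exists_family (L := L) h0 htri hpos hnv hne
  have hunit : ∀ a b : ↥(L.matDot (L.stdOrder m (Sigma.fst : BlockIdx nv → Fin r)
      hstd.1 hstd.2.1)), IsUnit (a * b) → IsUnit a :=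
    fun a b h => L.unit_of_mul_left _ h
  refine ⟨⟨⟨fun hlt => ?_, fun h => ?_⟩, ?_⟩, fun hne => ?_⟩
  · by_contra hne
    obtain ⟨a, a', hat, hrel⟩ := hfam hne
    exact hlt.ne (family_consequences hunit a a' hat hrel).1
  · refine finite_elasticity (E := fun a b : BlockIdx nv => m a.1 b.1) (fun a => h0 a.1)
      (fun a b c => htri a.1 b.1 c.1) (fun a b => ?_) _ (fun _ => Iff.rfl)
    by_cases hab : a.1 = b.1
    · simp [hab, h0]
    · exact (h _ _ hab).le
  · exact L.hereditary_iff (hO := fun _ => Iff.rfl) h0 htri hpos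
      (fun i => ⟨⟨i, ⟨0, hnv i⟩⟩, rfl⟩)
  · obtain ⟨a, a', hat, hrel⟩ := hfam hne
    have fc := family_consequences hunit a a' hat hrel
    exact ⟨⟨a, a', hat, hrel⟩, fc.2.1, fc.2.2⟩
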